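/- Let p ∈ (0,1) and let (G_t)_{t≥1} be the preferential attachment process with edge-steps with parameter p, and set α = (1−p)/(2−p). Let 𝒯₂²(G_t) be the number of triples of vertex indices i < j < k with i·j·k ≥ t^{3α} that form a triangle in G_t in which one of the three pairs is joined by an edge created at an edge-step and the remaining two pairs are joined by edges created at vertex-steps. Then there exists a constant C > 0, depending only on p, such that for all t ≥ 2: E[𝒯₂²(G_t)] ≤ C · t^{1−p} · (log t)⁶. -/

import Mathlib

open MeasureTheory Filter

attribute [local instance] Classical.propDecidable

/-- Degree of vertex `i` at time `t` computed from the endpoint process `ep`: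
the edge added at step `s` contributes `1` for each of its endpoints equal to `i`
(so a loop at `i` contributes `2`). -/
noncomputable def degOf {Ω : Type} (ep : ℕ → Ω → ℕ × ℕ) (t i : ℕ) (ω : Ω) : ℕ :=
  ∑ s ∈ Finset.Icc 1 t,
    ((if (ep s ω).1 = i then 1 else 0) + (if (ep s ω).2 = i then 1 else 0))

/-- The preferential attachment random graph process with edge-steps and parameter `p`.
`G_1` is a single vertex (labeled `1`) with a loop.  At each step `t + 1` (for `t ≥ 1`),
with probability `p` a vertex-step occurs: a new vertex `nv t + 1` is added together with an
edge to an old vertex `u`, chosen with probability `d_t(u) / (2t)`; with probability `1 - p`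
an edge-step occurs: an edge `{u, w}` is added, where `u` and `w` are chosen independently,
each with probability proportional to its degree.  The field `ep t` records the (ordered pair
of) endpoints of the unique edge added at step `t`, `nv t` is the number of vertices of `G_t`,
and `Z t` tells whether step `t` was a vertex-step.  The one-step conditional laws are
prescribed via conditional expectations with respect to a filtration `ℱ` to which the process
is adapted. -/
structure PAProcess (p : ℝ) where
  Ω : Type
  m0 : MeasurableSpace Ω
  μ : Measure Ω
  isProb : IsProbabilityMeasure μ
  ℱ : Filtration ℕ m0
  Z : ℕ → Ω → Bool
  nv : ℕ → Ω → ℕ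
  ep : ℕ → Ω → ℕ × ℕ
  nv_one : ∀ ω, nv 1 ω = 1
  ep_one : ∀ ω, ep 1 ω = (1, 1)
  nv_succ : ∀ t, 1 ≤ t → ∀ ω, nv (t + 1) ω = nv t ω + (if Z (t + 1) ω then 1 else 0)
  ep_vertexStep : ∀ t, 1 ≤ t → ∀ ω, Z (t + 1) ω = true →
    (ep (t + 1) ω).2 = nv t ω + 1 ∧ 1 ≤ (ep (t + 1) ω).1 ∧ (ep (t + 1) ω).1 ≤ nv t ω
  ep_edgeStep : ∀ t, 1 ≤ t → ∀ ω, Z (t + 1) ω = false →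
    1 ≤ (ep (t + 1) ω).1 ∧ (ep (t + 1) ω).1 ≤ nv t ω ∧
    1 ≤ (ep (t + 1) ω).2 ∧ (ep (t + 1) ω).2 ≤ nv t ω
  Z_meas : ∀ t, Measurable[ℱ t] (Z t)
  nv_meas : ∀ t, Measurable[ℱ t] (nv t)
  ep_meas : ∀ t, Measurable[ℱ t] (ep t)
  condLaw_Z : ∀ t, 1 ≤ t →
    μ[Set.indicator {ω | Z (t + 1) ω = true} (fun _ => (1 : ℝ)) | ℱ t] =ᵐ[μ] fun _ => p
  condLaw_vertex : ∀ t, 1 ≤ t → ∀ u,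
    μ[Set.indicator {ω | Z (t + 1) ω = true ∧ ep (t + 1) ω = (u, nv t ω + 1)}
        (fun _ => (1 : ℝ)) | ℱ t]
      =ᵐ[μ] fun ω => p * (degOf ep t u ω : ℝ) / (2 * t)
  condLaw_edge : ∀ t, 1 ≤ t → ∀ u w,
    μ[Set.indicator {ω | Z (t + 1) ω = false ∧ ep (t + 1) ω = (u, w)}
        (fun _ => (1 : ℝ)) | ℱ t]
      =ᵐ[μ] fun ω => (1 - p) * (degOf ep t u ω : ℝ) * (degOf ep t w ω : ℝ) / (2 * t) ^ 2

namespace PAProcess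

variable {p : ℝ} (P : PAProcess p)

/-- degree `d_t(i)` of vertex `i` in `G_t` (`0` if `i` is not yet present). -/
noncomputable def deg (t i : ℕ) (ω : P.Ω) : ℕ := degOf P.ep t i ω

/-- `i` and `j` are joined by at least one edge in `G_t`. -/
def Joined (t i j : ℕ) (ω : P.Ω) : Prop :=
  ∃ s ∈ Finset.Icc 1 t, P.ep s ω = (i, j) ∨ P.ep s ω = (j, i)

/-- number of triangles of `G_t`: sets of three distinct vertices pairwise joined by at
least one edge (counted without edge multiplicities). -/
noncomputable def triangles (t : ℕ) (ω : P.Ω) : ℕ :=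
  ((Finset.Icc 1 t ×ˢ Finset.Icc 1 t ×ˢ Finset.Icc 1 t).filter
    (fun q => q.1 < q.2.1 ∧ q.2.1 < q.2.2 ∧ P.Joined t q.1 q.2.1 ω ∧
      P.Joined t q.1 q.2.2 ω ∧ P.Joined t q.2.1 q.2.2 ω)).card

/-- number of cherries (paths of length 2) of `G_t`: unordered pairs of distinct edges of
`G_t` sharing a common endpoint.  The edges of `G_t` are indexed by their creation times
`1 ≤ s ≤ t`. -/
noncomputable def cherries (t : ℕ) (ω : P.Ω) : ℕ :=
  ((Finset.Icc 1 t ×ˢ Finset.Icc 1 t).filter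
    (fun q => q.1 < q.2 ∧
      ((P.ep q.1 ω).1 = (P.ep q.2 ω).1 ∨ (P.ep q.1 ω).1 = (P.ep q.2 ω).2 ∨
       (P.ep q.1 ω).2 = (P.ep q.2 ω).1 ∨ (P.ep q.1 ω).2 = (P.ep q.2 ω).2))).card

/-- global clustering coefficient of `G_t`. -/
noncomputable def clustering (t : ℕ) (ω : P.Ω) : ℝ :=
  3 * (P.triangles t ω : ℝ) / (P.cherries t ω : ℝ)

/-- clique number of `G_t`: the largest `k` such that `G_t` contains `k` distinct vertices
pairwise joined by at least one edge. -/
noncomputable def cliqueNum (t : ℕ) (ω : P.Ω) : ℕ :=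
  sSup {k | ∃ S : Finset ℕ, S ⊆ Finset.Icc 1 (P.nv t ω) ∧ S.card = k ∧
    ∀ i ∈ S, ∀ j ∈ S, i ≠ j → P.Joined t i j ω}

/-- `Γ_t(j)`: the number of distinct vertices joined to `j` by at least one edge in `G_t`. -/
noncomputable def nbrCount (t j : ℕ) (ω : P.Ω) : ℕ :=
  ((Finset.Icc 1 t).filter (fun i => P.Joined t i j ω)).card

/-- the time at which vertex `j` is added to the graph. -/
noncomputable def addTime (j : ℕ) (ω : P.Ω) : ℕ := sInf {t | P.nv t ω = j}

/-- at step `s` an edge joining `i` and `j` is added by an edge-step. -/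
def EdgeStepEdge (s i j : ℕ) (ω : P.Ω) : Prop :=
  2 ≤ s ∧ P.Z s ω = false ∧ (P.ep s ω = (i, j) ∨ P.ep s ω = (j, i))

/-- at step `s` an edge joining `i` and `j` is added by a vertex-step. -/
def VertexStepEdge (s i j : ℕ) (ω : P.Ω) : Prop :=
  2 ≤ s ∧ P.Z s ω = true ∧ (P.ep s ω = (i, j) ∨ P.ep s ω = (j, i))

/-- at step `s` vertex `j` is added by a vertex-step and its attaching edge connects it
to vertex `i`. -/
def AttachEdge (s i j : ℕ) (ω : P.Ω) : Prop :=
  2 ≤ s ∧ P.Z s ω = true ∧ P.ep s ω = (i, j) ∧ P.nv s ω = j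

/-- `i` and `j` are joined in `G_t` by at least one edge created at an edge-step. -/
def EdgeJoined (t i j : ℕ) (ω : P.Ω) : Prop :=
  ∃ s ∈ Finset.Icc 1 t, P.EdgeStepEdge s i j ω

/-- `i` and `j` are joined in `G_t` by at least one edge created at a vertex-step. -/
def VJoined (t i j : ℕ) (ω : P.Ω) : Prop :=
  ∃ s ∈ Finset.Icc 1 t, P.VertexStepEdge s i j ω

/-- `i` and `j` are joined in `G_t`, and exclusively by edges created at vertex-steps. -/
def OnlyVertexJoined (t i j : ℕ) (ω : P.Ω) : Prop :=
  P.Joined t i j ω ∧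
    ∀ s ∈ Finset.Icc 1 t, (P.ep s ω = (i, j) ∨ P.ep s ω = (j, i)) → P.Z s ω = true

end PAProcess

namespace PAProcess

attribute [local instance] PAProcess.m0 PAProcess.isProb

section

variable {p : ℝ} (P : PAProcess p)

/-- Bounded real functions of the process up to time `t`. -/
def BddAdapted (t : ℕ) (f : P.Ω → ℝ) : Prop :=
  Measurable[P.ℱ t] f ∧ ∃ C : ℝ, ∀ ω, |f ω| ≤ C

variable {P}

namespace BddAdapted

variable {t : ℕ} {f g : P.Ω → ℝ}

lemma const (t : ℕ) (c : ℝ) : P.BddAdapted t fun _ => c :=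
  ⟨measurable_const, |c|, fun _ => le_rfl⟩

lemma mono {s : ℕ} (hst : s ≤ t) (hf : P.BddAdapted s f) : P.BddAdapted t f :=
  ⟨hf.1.mono (P.ℱ.mono hst) le_rfl, hf.2⟩

lemma add (hf : P.BddAdapted t f) (hg : P.BddAdapted t g) :
    P.BddAdapted t fun ω => f ω + g ω := by
  obtain ⟨C, hC⟩ := hf.2
  obtain ⟨D, hD⟩ := hg.2
  exact ⟨hf.1.add hg.1, C + D, fun ω => (abs_add_le _ _).trans (add_le_add (hC ω) (hD ω))⟩

lemma mul (hf : P.BddAdapted t f) (hg : P.BddAdapted t g) :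
    P.BddAdapted t fun ω => f ω * g ω := by
  obtain ⟨C, hC⟩ := hf.2
  obtain ⟨D, hD⟩ := hg.2
  refine ⟨hf.1.mul hg.1, C * D, fun ω => ?_⟩
  rw [abs_mul]
  exact mul_le_mul (hC ω) (hD ω) (abs_nonneg _) ((abs_nonneg _).trans (hC ω))

lemma sum {ι : Type*} (S : Finset ι) {f : ι → P.Ω → ℝ}
    (hf : ∀ i ∈ S, P.BddAdapted t (f i)) : P.BddAdapted t fun ω => ∑ i ∈ S, f i ω := by
  induction S using Finset.induction_on with
  | empty => simpa using const t 0
  | insert a S ha ih =>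
    simp only [Finset.sum_insert ha]
    exact (hf a (Finset.mem_insert_self _ _)).add
      (ih fun i hi => hf i (Finset.mem_insert_of_mem hi))

lemma indicator {q : P.Ω → Prop} [∀ ω, Decidable (q ω)] (hq : MeasurableSet[P.ℱ t] {ω | q ω}) :
    P.BddAdapted t fun ω => if q ω then 1 else 0 := by
  refine ⟨Measurable.ite hq measurable_const measurable_const, 1, fun ω => ?_⟩
  beta_reduce
  split_ifs <;> simp

lemma setIndicator {A : Set P.Ω} (hA : MeasurableSet[P.ℱ t] A) :
    P.BddAdapted t (A.indicator fun _ => (1 : ℝ)) := by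
  refine ⟨measurable_const.indicator hA, 1, fun ω => ?_⟩
  by_cases h : ω ∈ A <;> simp [h]

lemma integrable (hf : P.BddAdapted t f) : Integrable f P.μ := by
  obtain ⟨C, hC⟩ := hf.2
  exact Integrable.of_bound (hf.1.mono (P.ℱ.le t) le_rfl).aestronglyMeasurable C
    (Eventually.of_forall hC)

end BddAdapted

variable (P)

/-- The degree of vertex `i` in `G_t`, as a real number. -/
noncomputable def degR (t i : ℕ) (ω : P.Ω) : ℝ := (degOf P.ep t i ω : ℝ)

/-- The indicator that step `s` is a vertex-step. -/
noncomputable def vtx (s : ℕ) (ω : P.Ω) : ℝ := if P.Z s ω = true then 1 else 0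

variable {P}

lemma degR_nonneg (t i : ℕ) (ω : P.Ω) : 0 ≤ P.degR t i ω := Nat.cast_nonneg _

lemma vtx_nonneg (s : ℕ) (ω : P.Ω) : 0 ≤ P.vtx s ω := by
  unfold vtx; split_ifs <;> simp

lemma vtx_le_one (s : ℕ) (ω : P.Ω) : P.vtx s ω ≤ 1 := by
  unfold vtx; split_ifs <;> simp

lemma degR_succ (t i : ℕ) (ω : P.Ω) :
    P.degR (t + 1) i ω = P.degR t i ω + (if (P.ep (t + 1) ω).1 = i then 1 else 0)
      + (if (P.ep (t + 1) ω).2 = i then 1 else 0) := by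
  unfold degR degOf
  rw [Finset.sum_Icc_succ_top (by omega)]
  push_cast
  ring

lemma degR_le_sq (t i : ℕ) (ω : P.Ω) : P.degR t i ω ≤ P.degR t i ω ^ 2 := by
  unfold degR
  exact_mod_cast Nat.le_self_pow two_ne_zero _

lemma nv_mono {s t : ℕ} (hs : 1 ≤ s) (hst : s ≤ t) (ω : P.Ω) : P.nv s ω ≤ P.nv t ω := by
  induction t, hst using Nat.le_induction with
  | base => exact le_rfl
  | succ n hn ih =>
    rw [P.nv_succ n (hs.trans hn)]
    exact ih.trans (Nat.le_add_right _ _)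

lemma nv_le {t : ℕ} (ht : 1 ≤ t) (ω : P.Ω) : P.nv t ω ≤ t := by
  induction t, ht using Nat.le_induction with
  | base => rw [P.nv_one]
  | succ n hn ih =>
    rw [P.nv_succ n hn]
    split_ifs <;> omega

lemma ep_vertexStep' {s : ℕ} (hs : 2 ≤ s) {ω : P.Ω} (hZ : P.Z s ω = true) :
    (P.ep s ω).2 = P.nv s ω ∧ P.nv s ω = P.nv (s - 1) ω + 1 ∧ 1 ≤ (P.ep s ω).1 ∧
      (P.ep s ω).1 < (P.ep s ω).2 := by
  obtain ⟨r, rfl⟩ : ∃ r, s = r + 1 := ⟨s - 1, by omega⟩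
  have h := P.ep_vertexStep r (by omega) ω hZ
  have h' := P.nv_succ r (by omega) ω
  rw [hZ, if_pos rfl] at h'
  rw [h']
  refine ⟨h.1, rfl, h.2.1, ?_⟩
  omega

lemma ep_le_nv {s : ℕ} (hs : 1 ≤ s) (ω : P.Ω) :
    1 ≤ (P.ep s ω).1 ∧ (P.ep s ω).1 ≤ P.nv s ω ∧ 1 ≤ (P.ep s ω).2 ∧
      (P.ep s ω).2 ≤ P.nv s ω := by
  rcases hs.eq_or_lt with rfl | hs
  · simp [P.ep_one, P.nv_one]
  · cases hZ : P.Z s ω with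
    | true =>
      have := ep_vertexStep' hs hZ
      omega
    | false =>
      obtain ⟨r, rfl⟩ : ∃ r, s = r + 1 := ⟨s - 1, by omega⟩
      have h := P.ep_edgeStep r (by omega) ω hZ
      have := nv_mono (P := P) (s := r) (t := r + 1) (by omega) (by omega) ω
      omega

lemma degR_eq_zero {t i : ℕ} {ω : P.Ω} (h : i = 0 ∨ P.nv t ω < i) : P.degR t i ω = 0 := by
  unfold degR degOf
  rw [Nat.cast_eq_zero]
  refine Finset.sum_eq_zero fun s hs => ?_
  rw [Finset.mem_Icc] at hs
  have h1 := ep_le_nv (P := P) hs.1 ω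
  have h2 := nv_mono (P := P) hs.1 hs.2 ω
  rw [if_neg (by omega), if_neg (by omega), add_zero]

lemma sum_degR {t : ℕ} (ht : 1 ≤ t) (ω : P.Ω) :
    ∑ i ∈ Finset.Icc 1 t, P.degR t i ω = 2 * t := by
  unfold degR degOf
  rw [← Nat.cast_sum, Finset.sum_comm]
  have : ∀ s ∈ Finset.Icc 1 t, ∑ i ∈ Finset.Icc 1 t,
      ((if (P.ep s ω).1 = i then 1 else 0) + (if (P.ep s ω).2 = i then 1 else 0)) = 2 := by
    intro s hs
    rw [Finset.mem_Icc] at hs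
    have h1 := ep_le_nv (P := P) hs.1 ω
    have h2 := nv_mono (P := P) hs.1 hs.2 ω
    have h3 := nv_le (P := P) ht ω
    rw [Finset.sum_add_distrib, Finset.sum_ite_eq, Finset.sum_ite_eq,
      if_pos (Finset.mem_Icc.2 (by omega)), if_pos (Finset.mem_Icc.2 (by omega))]
  rw [Finset.sum_congr rfl this]
  simp [mul_comm]

lemma sum_degR_mul_ite {t : ℕ} (ht : 1 ≤ t) (x : ℕ) (ω : P.Ω) :
    ∑ u ∈ Finset.Icc 1 t, P.degR t u ω * (if u = x then 1 else 0) = P.degR t x ω := by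
  simp only [mul_ite, mul_one, mul_zero, Finset.sum_ite_eq', Finset.mem_Icc]
  split_ifs with h
  · rfl
  · refine (degR_eq_zero ?_).symm
    have := nv_le (P := P) ht ω
    omega

lemma measurable_ep {s t : ℕ} (hst : s ≤ t) : Measurable[P.ℱ t] (P.ep s) :=
  (P.ep_meas s).mono (P.ℱ.mono hst) le_rfl

lemma bddAdapted_degR {t : ℕ} {x : P.Ω → ℕ} (hx : Measurable[P.ℱ t] x) :
    P.BddAdapted t fun ω => P.degR t (x ω) ω := by
  unfold degR degOf
  push_cast
  refine BddAdapted.sum _ fun s hs => ?_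
  have he := measurable_ep (P := P) (Finset.mem_Icc.1 hs).2
  exact (BddAdapted.indicator (measurableSet_eq_fun he.fst hx)).add
    (BddAdapted.indicator (measurableSet_eq_fun he.snd hx))

lemma bddAdapted_vtx {s t : ℕ} (hst : s ≤ t) : P.BddAdapted t (P.vtx s) := by
  refine BddAdapted.indicator (q := fun ω => P.Z s ω = true) ?_
  exact measurableSet_eq_fun ((P.Z_meas s).mono (P.ℱ.mono hst) le_rfl) measurable_const

lemma integral_indicator_mul {t : ℕ} {B : Set P.Ω} (hB : MeasurableSet B) {q f : P.Ω → ℝ}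
    (hq : P.μ[B.indicator (fun _ => (1 : ℝ)) | P.ℱ t] =ᵐ[P.μ] q) (hf : P.BddAdapted t f) :
    ∫ ω, B.indicator (fun _ => (1 : ℝ)) ω * f ω ∂P.μ = ∫ ω, q ω * f ω ∂P.μ := by
  have hi : Integrable (B.indicator (fun _ => (1 : ℝ))) P.μ :=
    (integrable_const _).indicator hB
  obtain ⟨C, hC⟩ := hf.2
  have hm : Integrable (B.indicator (fun _ => (1 : ℝ)) * f) P.μ :=
    hi.mul_bdd (c := C) (hf.1.mono (P.ℱ.le t) le_rfl).aestronglyMeasurable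
      (Eventually.of_forall hC)
  have h := condExp_mul_of_stronglyMeasurable_right hf.1.stronglyMeasurable hm hi
  calc ∫ ω, B.indicator (fun _ => (1 : ℝ)) ω * f ω ∂P.μ
      = ∫ ω, (P.μ[B.indicator (fun _ => (1 : ℝ)) * f | P.ℱ t]) ω ∂P.μ :=
        (integral_condExp (P.ℱ.le t)).symm
    _ = ∫ ω, q ω * f ω ∂P.μ := by
        refine integral_congr_ae ?_
        filter_upwards [h, hq] with ω h1 h2
        rw [h1, Pi.mul_apply, h2]

/-- Average over the law of step `t + 1` given the past: `G u` is the value when a new vertex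
attaches to `u`, and `H u w` the value when the edge `(u, w)` is added by an edge-step. -/
noncomputable def stepMean (P : PAProcess p) (t : ℕ) (G : ℕ → P.Ω → ℝ)
    (H : ℕ → ℕ → P.Ω → ℝ) (ω : P.Ω) : ℝ :=
  (∑ u ∈ Finset.Icc 1 t, p * P.degR t u ω / (2 * t) * G u ω) +
    ∑ u ∈ Finset.Icc 1 t, ∑ w ∈ Finset.Icc 1 t,
      (1 - p) * P.degR t u ω * P.degR t w ω / (2 * t) ^ 2 * H u w ω

lemma integral_le_of_step {t : ℕ} (ht : 1 ≤ t) {X R : P.Ω → ℝ} {G : ℕ → P.Ω → ℝ}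
    {H : ℕ → ℕ → P.Ω → ℝ} (hX : P.BddAdapted (t + 1) X) (hR : P.BddAdapted t R)
    (hG : ∀ u, P.BddAdapted t (G u)) (hH : ∀ u w, P.BddAdapted t (H u w))
    (hXG : ∀ ω, P.Z (t + 1) ω = true → X ω ≤ G (P.ep (t + 1) ω).1 ω)
    (hXH : ∀ ω, P.Z (t + 1) ω = false → X ω ≤ H (P.ep (t + 1) ω).1 (P.ep (t + 1) ω).2 ω)
    (hGHR : ∀ ω, P.stepMean t G H ω ≤ R ω) :
    ∫ ω, X ω ∂P.μ ≤ ∫ ω, R ω ∂P.μ := by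
  have hZm : Measurable[P.ℱ (t + 1)] (P.Z (t + 1)) := P.Z_meas (t + 1)
  have hem : Measurable[P.ℱ (t + 1)] (P.ep (t + 1)) := P.ep_meas (t + 1)
  have hnm : Measurable[P.ℱ (t + 1)] (P.nv t) :=
    (P.nv_meas t).mono (P.ℱ.mono (Nat.le_succ t)) le_rfl
  let A : ℕ → Set P.Ω := fun u => {ω | P.Z (t + 1) ω = true ∧ P.ep (t + 1) ω = (u, P.nv t ω + 1)}
  let B : ℕ → ℕ → Set P.Ω := fun u w => {ω | P.Z (t + 1) ω = false ∧ P.ep (t + 1) ω = (u, w)}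
  have hA : ∀ u, MeasurableSet[P.ℱ (t + 1)] (A u) := fun u =>
    (measurableSet_eq_fun hZm measurable_const).inter
      (measurableSet_eq_fun hem (measurable_const.prodMk (hnm.add_const 1)))
  have hB : ∀ u w, MeasurableSet[P.ℱ (t + 1)] (B u w) := fun u w =>
    (measurableSet_eq_fun hZm measurable_const).inter
      (measurableSet_eq_fun hem measurable_const)
  have hAi : ∀ u, P.BddAdapted (t + 1) fun ω => (A u).indicator (fun _ => (1 : ℝ)) ω * G u ω :=
    fun u => (BddAdapted.setIndicator (hA u)).mul ((hG u).mono (Nat.le_succ t))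
  have hBi : ∀ u w, P.BddAdapted (t + 1) fun ω =>
      (B u w).indicator (fun _ => (1 : ℝ)) ω * H u w ω :=
    fun u w => (BddAdapted.setIndicator (hB u w)).mul ((hH u w).mono (Nat.le_succ t))
  have hd : ∀ u, P.BddAdapted t fun ω => P.degR t u ω := fun u =>
    bddAdapted_degR measurable_const
  have hAq : ∀ u, P.BddAdapted t fun ω => p * P.degR t u ω / (2 * t) * G u ω := fun u => by
    have := (((BddAdapted.const t p).mul (hd u)).mul (BddAdapted.const t (2 * (t : ℝ))⁻¹)).mul
      (hG u)
    simpa only [div_eq_mul_inv] using this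
  have hBq : ∀ u w, P.BddAdapted t fun ω =>
      (1 - p) * P.degR t u ω * P.degR t w ω / (2 * t) ^ 2 * H u w ω := fun u w => by
    have := ((((BddAdapted.const t (1 - p)).mul (hd u)).mul (hd w)).mul
      (BddAdapted.const t ((2 * (t : ℝ)) ^ 2)⁻¹)).mul (hH u w)
    simpa only [div_eq_mul_inv] using this
  have hA1 := BddAdapted.sum (Finset.Icc 1 t) fun u _ => hAi u
  have hB1 := BddAdapted.sum (Finset.Icc 1 t) fun u _ =>
    BddAdapted.sum (Finset.Icc 1 t) fun w _ => hBi u w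
  have hA2 := BddAdapted.sum (Finset.Icc 1 t) fun u _ => hAq u
  have hB2 := BddAdapted.sum (Finset.Icc 1 t) fun u _ =>
    BddAdapted.sum (Finset.Icc 1 t) fun w _ => hBq u w
  calc ∫ ω, X ω ∂P.μ
      ≤ ∫ ω, (∑ u ∈ Finset.Icc 1 t, (A u).indicator (fun _ => (1 : ℝ)) ω * G u ω) +
          ∑ u ∈ Finset.Icc 1 t, ∑ w ∈ Finset.Icc 1 t,
            (B u w).indicator (fun _ => (1 : ℝ)) ω * H u w ω ∂P.μ := by
        refine integral_mono hX.integrable (hA1.add hB1).integrable fun ω => ?_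
        have hn := nv_le (P := P) ht ω
        cases hZ : P.Z (t + 1) ω with
        | true =>
          obtain ⟨h2, h1, h1'⟩ := P.ep_vertexStep t ht ω hZ
          have e1 : ∀ u, (A u).indicator (fun _ => (1 : ℝ)) ω =
              if (P.ep (t + 1) ω).1 = u then 1 else 0 := fun u => by
            simp [A, Set.indicator_apply, hZ, Prod.ext_iff, h2]
          have e2 : ∀ u w, (B u w).indicator (fun _ => (1 : ℝ)) ω = 0 := fun u w => by
            simp [B, hZ]
          simp only [e1, e2, zero_mul, Finset.sum_const_zero, add_zero, ite_mul, one_mul,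
            Finset.sum_ite_eq]
          rw [if_pos (Finset.mem_Icc.2 ⟨h1, h1'.trans hn⟩)]
          exact hXG ω hZ
        | false =>
          obtain ⟨h1, h1', h2, h2'⟩ := P.ep_edgeStep t ht ω hZ
          have e1 : ∀ u, (A u).indicator (fun _ => (1 : ℝ)) ω = 0 := fun u => by
            simp [A, hZ]
          have e2 : ∀ u w, (B u w).indicator (fun _ => (1 : ℝ)) ω =
              if (P.ep (t + 1) ω).1 = u then (if (P.ep (t + 1) ω).2 = w then 1 else 0)
                else 0 := fun u w => by
            simp only [B, Set.indicator_apply, Set.mem_ofPred_eq, hZ, Prod.ext_iff, true_and]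
            split_ifs <;> simp_all
          simp only [e1, e2, zero_mul, Finset.sum_const_zero, zero_add, ite_mul, one_mul]
          rw [Finset.sum_eq_single_of_mem (P.ep (t + 1) ω).1
            (Finset.mem_Icc.2 ⟨h1, h1'.trans hn⟩) (fun b _ hb => by simp [hb.symm])]
          simp only [if_true, Finset.sum_ite_eq]
          rw [if_pos (Finset.mem_Icc.2 ⟨h2, h2'.trans hn⟩)]
          exact hXH ω hZ
    _ = ∫ ω, P.stepMean t G H ω ∂P.μ := by
        unfold stepMean
        rw [integral_add hA1.integrable hB1.integrable, integral_add hA2.integrable hB2.integrable,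
          integral_finsetSum _ fun u _ => (hAi u).integrable,
          integral_finsetSum _ fun u _ => (hAq u).integrable,
          integral_finsetSum _ fun u _ =>
            (BddAdapted.sum (Finset.Icc 1 t) fun w _ => hBi u w).integrable,
          integral_finsetSum _ fun u _ =>
            (BddAdapted.sum (Finset.Icc 1 t) fun w _ => hBq u w).integrable]
        refine congrArg₂ _ (Finset.sum_congr rfl fun u _ => ?_)
          (Finset.sum_congr rfl fun u _ => ?_)
        · exact integral_indicator_mul (P.ℱ.le _ _ (hA u)) (P.condLaw_vertex t ht u) (hG u)
        · rw [integral_finsetSum _ fun w _ => (hBi u w).integrable,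
            integral_finsetSum _ fun w _ => (hBq u w).integrable]
          exact Finset.sum_congr rfl fun w _ =>
            integral_indicator_mul (P.ℱ.le _ _ (hB u w)) (P.condLaw_edge t ht u w) (hH u w)
    _ ≤ ∫ ω, R ω ∂P.μ := integral_mono (hA2.add hB2).integrable hR.integrable hGHR

lemma stepMean_eq (t : ℕ) (G : ℕ → P.Ω → ℝ) (H : ℕ → ℕ → P.Ω → ℝ) (ω : P.Ω) :
    P.stepMean t G H ω = p / (2 * t) * ∑ u ∈ Finset.Icc 1 t, P.degR t u ω * G u ω +
      (1 - p) / (2 * t) ^ 2 * ∑ u ∈ Finset.Icc 1 t, P.degR t u ω *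
        ∑ w ∈ Finset.Icc 1 t, P.degR t w ω * H u w ω := by
  unfold stepMean
  simp only [Finset.mul_sum]
  refine congrArg₂ _ (Finset.sum_congr rfl fun u _ => by ring)
    (Finset.sum_congr rfl fun u _ => Finset.sum_congr rfl fun w _ => by ring)

lemma sum_degR_affine {t : ℕ} (ht : 1 ≤ t) (ω : P.Ω) (x y : ℕ) (A B C : ℝ) :
    ∑ u ∈ Finset.Icc 1 t, P.degR t u ω *
        (A + B * (if u = x then 1 else 0) + C * (if u = y then 1 else 0)) =
      2 * t * A + B * P.degR t x ω + C * P.degR t y ω := by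
  rw [← sum_degR ht ω, ← sum_degR_mul_ite ht x ω, ← sum_degR_mul_ite ht y ω, Finset.sum_mul,
    Finset.mul_sum, Finset.mul_sum, ← Finset.sum_add_distrib, ← Finset.sum_add_distrib]
  exact Finset.sum_congr rfl fun u _ => by ring

lemma integral_pair_step {t : ℕ} (ht : 1 ≤ t) {g : P.Ω → ℝ} {x y : P.Ω → ℕ}
    (hg : P.BddAdapted t g) (hx : Measurable[P.ℱ t] x) (hy : Measurable[P.ℱ t] y)
    (hg0 : ∀ ω, 0 ≤ g ω)
    (hxy : ∀ ω, g ω ≠ 0 → x ω ≠ y ω ∧ x ω ≤ P.nv t ω ∧ y ω ≤ P.nv t ω) (hp0 : 0 ≤ p) :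
    ∫ ω, g ω * (P.degR (t + 1) (x ω) ω * P.degR (t + 1) (y ω) ω) ∂P.μ ≤
      ∫ ω, (1 + (2 - p) / t + 1 / (2 * t ^ 2)) *
        (g ω * (P.degR t (x ω) ω * P.degR t (y ω) ω)) ∂P.μ := by
  have ht0 : (0 : ℝ) < t := by exact_mod_cast ht
  have hdx := bddAdapted_degR hx
  have hdy := bddAdapted_degR hy
  have hm : Measurable[P.ℱ (t + 1)] x := hx.mono (P.ℱ.mono (Nat.le_succ t)) le_rfl
  have hm' : Measurable[P.ℱ (t + 1)] y := hy.mono (P.ℱ.mono (Nat.le_succ t)) le_rfl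
  have hi : ∀ u, P.BddAdapted t fun ω => if u = x ω then 1 else 0 := fun u =>
    BddAdapted.indicator (measurableSet_eq_fun measurable_const hx)
  have hj : ∀ u, P.BddAdapted t fun ω => if u = y ω then 1 else 0 := fun u =>
    BddAdapted.indicator (measurableSet_eq_fun measurable_const hy)
  refine integral_le_of_step ht
    (G := fun u ω => g ω * (P.degR t (x ω) ω * P.degR t (y ω) ω
      + P.degR t (y ω) ω * (if u = x ω then 1 else 0)
      + P.degR t (x ω) ω * (if u = y ω then 1 else 0)))
    (H := fun u w ω => g ω * ((P.degR t (x ω) ω * P.degR t (y ω) ω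
      + P.degR t (y ω) ω * (if u = x ω then 1 else 0)
      + P.degR t (x ω) ω * (if u = y ω then 1 else 0))
      + (P.degR t (y ω) ω + (if u = y ω then 1 else 0)) * (if w = x ω then 1 else 0)
      + (P.degR t (x ω) ω + (if u = x ω then 1 else 0)) * (if w = y ω then 1 else 0)))
    ((hg.mono (Nat.le_succ t)).mul ((bddAdapted_degR hm).mul (bddAdapted_degR hm')))
    ((BddAdapted.const t _).mul (hg.mul (hdx.mul hdy)))
    (fun u => hg.mul (((hdx.mul hdy).add (hdy.mul (hi u))).add (hdx.mul (hj u))))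
    (fun u w => hg.mul ((((hdx.mul hdy).add (hdy.mul (hi u))).add (hdx.mul (hj u))).add
      ((hdy.add (hj u)).mul (hi w)) |>.add ((hdx.add (hi u)).mul (hj w)))) ?_ ?_ ?_
  · intro ω hZ
    by_cases h0 : g ω = 0
    · simp [h0]
    · obtain ⟨hne, hxn, hyn⟩ := hxy ω h0
      have h2 := (P.ep_vertexStep t ht ω hZ).1
      refine mul_le_mul_of_nonneg_left ?_ (hg0 ω)
      rw [degR_succ, degR_succ, if_neg (c := (P.ep (t + 1) ω).2 = x ω) (by omega),
        if_neg (c := (P.ep (t + 1) ω).2 = y ω) (by omega)]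
      by_cases hux : (P.ep (t + 1) ω).1 = x ω
      · rw [if_pos hux, if_neg (by omega)]
        linarith
      · rw [if_neg hux]
        linarith
  · intro ω hZ
    by_cases h0 : g ω = 0
    · simp [h0]
    · obtain ⟨hne, hxn, hyn⟩ := hxy ω h0
      refine mul_le_mul_of_nonneg_left ?_ (hg0 ω)
      rw [degR_succ, degR_succ]
      by_cases hux : (P.ep (t + 1) ω).1 = x ω <;> by_cases hwx : (P.ep (t + 1) ω).2 = x ω
      · rw [if_pos hux, if_pos hwx, if_neg (by omega), if_neg (by omega)]
        linarith
      · rw [if_pos hux, if_neg hwx, if_neg (by omega)]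
        linarith
      · rw [if_neg hux, if_pos hwx, if_neg (c := (P.ep (t + 1) ω).2 = y ω) (by omega)]
        linarith
      · rw [if_neg hux, if_neg hwx]
        linarith
  · intro ω
    have hD : 0 ≤ g ω * (P.degR t (x ω) ω * P.degR t (y ω) ω) :=
      mul_nonneg (hg0 ω) (mul_nonneg (degR_nonneg _ _ _) (degR_nonneg _ _ _))
    rw [stepMean_eq]
    simp only [mul_left_comm _ (g ω), ← Finset.mul_sum]
    simp only [sum_degR_affine ht]
    have : ∀ u, (2 * t * (P.degR t (x ω) ω * P.degR t (y ω) ω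
        + P.degR t (y ω) ω * (if u = x ω then 1 else 0)
        + P.degR t (x ω) ω * (if u = y ω then 1 else 0))
        + (P.degR t (y ω) ω + (if u = y ω then 1 else 0)) * P.degR t (x ω) ω
        + (P.degR t (x ω) ω + (if u = x ω then 1 else 0)) * P.degR t (y ω) ω : ℝ) =
        (2 * t + 2) * (P.degR t (x ω) ω * P.degR t (y ω) ω)
        + (2 * t + 1) * P.degR t (y ω) ω * (if u = x ω then 1 else 0)
        + (2 * t + 1) * P.degR t (x ω) ω * (if u = y ω then 1 else 0) := fun u => by ring
    simp only [this, sum_degR_affine ht]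
    set D := P.degR t (x ω) ω * P.degR t (y ω) ω with hDdef
    calc _ = (1 + (2 - p) / t + (1 - p) / (2 * t ^ 2)) * (g ω * D) := by
          rw [hDdef]; field_simp; ring
      _ ≤ (1 + (2 - p) / t + 1 / (2 * t ^ 2)) * (g ω * D) := by
          refine mul_le_mul_of_nonneg_right ?_ hD
          gcongr
          linarith
      _ = _ := by ring

variable (P)

/-- The sum of the squared degrees in `G_t`. -/
noncomputable def sqSum (t : ℕ) (ω : P.Ω) : ℝ := ∑ i ∈ Finset.Icc 1 t, P.degR t i ω ^ 2

/-- Sum, over the edges of `G_t` created at vertex-steps, of the product of the degrees of the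
two endpoints. -/
noncomputable def edgeWeight (t : ℕ) (ω : P.Ω) : ℝ :=
  ∑ a ∈ Finset.Icc 2 t, P.vtx a ω * (P.degR t (P.ep a ω).1 ω * P.degR t (P.ep a ω).2 ω)

/-- One of the two entries of a pair. -/
def sel (c : Bool) (e : ℕ × ℕ) : ℕ := if c = true then e.1 else e.2

/-- The indicator that `a` and `b` are vertex-steps and that the vertex born at step `b` attaches
to the endpoint of the step-`a` edge selected by `c`. -/
noncomputable def link (c : Bool) (a b : ℕ) (ω : P.Ω) : ℝ :=
  P.vtx a ω * P.vtx b ω * if (P.ep b ω).1 = sel c (P.ep a ω) then 1 else 0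

/-- Sum, over the paths of two vertex-step edges described by `link c`, of the product of the
degrees in `G_t` of the two end vertices of the path. -/
noncomputable def pathWeight (c : Bool) (t : ℕ) (ω : P.Ω) : ℝ :=
  ∑ b ∈ Finset.Icc 2 t, ∑ a ∈ Finset.Ico 2 b,
    P.link c a b ω * (P.degR t (sel (!c) (P.ep a ω)) ω * P.degR t (P.ep b ω).2 ω)

/-- The number of orientations in which the edge added at step `s` joins `x` and `y`. -/
noncomputable def hit (s x y : ℕ) (ω : P.Ω) : ℝ :=
  (if P.ep s ω = (x, y) then 1 else 0) + if P.ep s ω = (y, x) then 1 else 0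

/-- The number of paths described by `link c` closed into a triangle at the edge-step `s`. -/
noncomputable def closing (c : Bool) (s : ℕ) (ω : P.Ω) : ℝ :=
  ∑ b ∈ Finset.Ico 2 s, ∑ a ∈ Finset.Ico 2 b,
    P.link c a b ω * ((1 - P.vtx s ω) * P.hit s (sel (!c) (P.ep a ω)) (P.ep b ω).2 ω)

variable {P}

lemma link_nonneg (c : Bool) (a b : ℕ) (ω : P.Ω) : 0 ≤ P.link c a b ω := by
  unfold link
  refine mul_nonneg (mul_nonneg (vtx_nonneg _ _) (vtx_nonneg _ _)) ?_
  split_ifs <;> simp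

lemma hit_nonneg (s x y : ℕ) (ω : P.Ω) : 0 ≤ P.hit s x y ω := by
  unfold hit
  split_ifs <;> simp

lemma sqSum_nonneg (t : ℕ) (ω : P.Ω) : 0 ≤ P.sqSum t ω :=
  Finset.sum_nonneg fun _ _ => sq_nonneg _

lemma measurable_sel (c : Bool) {s t : ℕ} (hst : s ≤ t) :
    Measurable[P.ℱ t] fun ω => sel c (P.ep s ω) := by
  cases c
  · simpa [sel] using (measurable_ep (P := P) hst).snd
  · simpa [sel] using (measurable_ep (P := P) hst).fst

lemma bddAdapted_sqSum (t : ℕ) : P.BddAdapted t (P.sqSum t) := by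
  unfold sqSum
  simp only [sq]
  exact BddAdapted.sum _ fun i _ =>
    (bddAdapted_degR measurable_const).mul (bddAdapted_degR measurable_const)

lemma bddAdapted_edgeTerm {a t : ℕ} (hat : a ≤ t) : P.BddAdapted t fun ω =>
    P.vtx a ω * (P.degR t (P.ep a ω).1 ω * P.degR t (P.ep a ω).2 ω) :=
  (bddAdapted_vtx hat).mul ((bddAdapted_degR (measurable_ep hat).fst).mul
    (bddAdapted_degR (measurable_ep hat).snd))

lemma bddAdapted_link (c : Bool) {a b t : ℕ} (ha : a ≤ t) (hb : b ≤ t) :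
    P.BddAdapted t (P.link c a b) :=
  ((bddAdapted_vtx ha).mul (bddAdapted_vtx hb)).mul (BddAdapted.indicator
    (measurableSet_eq_fun (measurable_ep hb).fst (measurable_sel c ha)))

lemma bddAdapted_pathTerm (c : Bool) {a b t : ℕ} (ha : a ≤ t) (hb : b ≤ t) :
    P.BddAdapted t fun ω =>
      P.link c a b ω * (P.degR t (sel (!c) (P.ep a ω)) ω * P.degR t (P.ep b ω).2 ω) :=
  (bddAdapted_link c ha hb).mul ((bddAdapted_degR (measurable_sel (!c) ha)).mul
    (bddAdapted_degR (measurable_ep hb).snd))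

lemma bddAdapted_hit {s t : ℕ} (hst : s ≤ t) {x y : P.Ω → ℕ} (hx : Measurable[P.ℱ t] x)
    (hy : Measurable[P.ℱ t] y) : P.BddAdapted t fun ω => P.hit s (x ω) (y ω) ω :=
  (BddAdapted.indicator (measurableSet_eq_fun (measurable_ep hst) (hx.prodMk hy))).add
    (BddAdapted.indicator (measurableSet_eq_fun (measurable_ep hst) (hy.prodMk hx)))

lemma bddAdapted_closingTerm (c : Bool) {a b s : ℕ} (ha : a ≤ s) (hb : b ≤ s) :
    P.BddAdapted s fun ω =>
      P.link c a b ω * ((1 - P.vtx s ω) * P.hit s (sel (!c) (P.ep a ω)) (P.ep b ω).2 ω) := by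
  have h : P.BddAdapted s fun ω => 1 - P.vtx s ω := by
    simpa [sub_eq_add_neg] using (BddAdapted.const s 1).add
      ((BddAdapted.const s (-1)).mul (bddAdapted_vtx le_rfl))
  exact (bddAdapted_link c ha hb).mul (h.mul
    (bddAdapted_hit le_rfl (measurable_sel (!c) ha) (measurable_ep hb).snd))

lemma bddAdapted_closing (c : Bool) (s : ℕ) : P.BddAdapted s (P.closing c s) := by
  refine BddAdapted.sum _ fun b hb => BddAdapted.sum _ fun a ha => ?_
  have hb := Finset.mem_Ico.1 hb
  have ha := Finset.mem_Ico.1 ha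
  exact bddAdapted_closingTerm c (by omega) (by omega)

lemma integral_sum_le {ι : Type*} {s t : ℕ} (S : Finset ι) {f h : ι → P.Ω → ℝ}
    (hf : ∀ i ∈ S, P.BddAdapted s (f i)) (hh : ∀ i ∈ S, P.BddAdapted t (h i))
    (hfh : ∀ i ∈ S, ∫ ω, f i ω ∂P.μ ≤ ∫ ω, h i ω ∂P.μ) :
    ∫ ω, ∑ i ∈ S, f i ω ∂P.μ ≤ ∫ ω, ∑ i ∈ S, h i ω ∂P.μ := by
  rw [integral_finsetSum _ fun i hi => (hf i hi).integrable,
    integral_finsetSum _ fun i hi => (hh i hi).integrable]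
  exact Finset.sum_le_sum hfh

lemma sqSum_succ_le {t : ℕ} (ht : 1 ≤ t) (ω : P.Ω) :
    P.sqSum (t + 1) ω ≤ P.sqSum t ω + 4 + 2 * P.degR t (P.ep (t + 1) ω).1 ω
      + 2 * P.degR t (P.ep (t + 1) ω).2 ω := by
  have h1 := ep_le_nv (P := P) (s := t + 1) (by omega) ω
  have h2 := nv_le (P := P) (t := t + 1) (by omega) ω
  have h3 := nv_le (P := P) ht ω
  set u := (P.ep (t + 1) ω).1 with hu
  set w := (P.ep (t + 1) ω).2 with hw
  have key : ∀ i ∈ Finset.Icc 1 (t + 1), P.degR (t + 1) i ω ^ 2 ≤ P.degR t i ω ^ 2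
      + (if u = i then 2 * P.degR t i ω + 2 else 0)
      + (if w = i then 2 * P.degR t i ω + 2 else 0) := by
    intro i _
    rw [degR_succ, ← hu, ← hw]
    split_ifs <;> nlinarith [degR_nonneg t i ω]
  calc P.sqSum (t + 1) ω ≤ _ := Finset.sum_le_sum key
    _ = _ := by
      rw [Finset.sum_add_distrib, Finset.sum_add_distrib, Finset.sum_ite_eq, Finset.sum_ite_eq,
        if_pos (Finset.mem_Icc.2 (by omega)), if_pos (Finset.mem_Icc.2 (by omega)),
        Finset.sum_Icc_succ_top (by omega), degR_eq_zero (t := t) (i := t + 1) (by omega)]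
      unfold sqSum
      ring

lemma sum_degR_mul_affine {t : ℕ} (ht : 1 ≤ t) (ω : P.Ω) (A B : ℝ) :
    ∑ u ∈ Finset.Icc 1 t, P.degR t u ω * (A + B * P.degR t u ω) =
      2 * t * A + B * P.sqSum t ω := by
  unfold sqSum
  rw [← sum_degR ht ω, Finset.sum_mul, Finset.mul_sum, ← Finset.sum_add_distrib]
  exact Finset.sum_congr rfl fun u _ => by ring

lemma integral_sqSum_succ_le {t : ℕ} (ht : 1 ≤ t) :
    ∫ ω, P.sqSum (t + 1) ω ∂P.μ ≤
      (1 + (2 - p) / t) * ∫ ω, P.sqSum t ω ∂P.μ + 4 := by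
  have ht0 : (0 : ℝ) < t := by exact_mod_cast ht
  have hU := bddAdapted_sqSum (P := P) t
  have hd : ∀ u, P.BddAdapted t fun ω => P.degR t u ω := fun u =>
    bddAdapted_degR measurable_const
  have hc : ∀ c : ℝ, P.BddAdapted t fun _ => c := BddAdapted.const t
  calc ∫ ω, P.sqSum (t + 1) ω ∂P.μ
      ≤ ∫ ω, (1 + (2 - p) / t) * P.sqSum t ω + 4 ∂P.μ := by
        refine integral_le_of_step ht
          (G := fun u ω => P.sqSum t ω + 4 + 2 * P.degR t u ω)
          (H := fun u w ω => P.sqSum t ω + 4 + 2 * P.degR t u ω + 2 * P.degR t w ω)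
          (bddAdapted_sqSum (t + 1)) (((hc _).mul hU).add (hc 4))
          (fun u => (hU.add (hc 4)).add ((hc 2).mul (hd u)))
          (fun u w => ((hU.add (hc 4)).add ((hc 2).mul (hd u))).add ((hc 2).mul (hd w))) ?_ ?_ ?_
        · intro ω hZ
          have h := sqSum_succ_le ht ω
          have h2 := (P.ep_vertexStep t ht ω hZ).1
          rwa [degR_eq_zero (i := (P.ep (t + 1) ω).2) (by omega), mul_zero, add_zero] at h
        · intro ω _
          exact sqSum_succ_le ht ω
        · intro ω
          rw [stepMean_eq]
          simp only [sum_degR_mul_affine ht]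
          have : ∀ u, 2 * t * (P.sqSum t ω + 4 + 2 * P.degR t u ω) + 2 * P.sqSum t ω =
              (2 * t * (P.sqSum t ω + 4) + 2 * P.sqSum t ω) + 4 * t * P.degR t u ω :=
            fun u => by ring
          simp only [this, sum_degR_mul_affine ht]
          refine le_of_eq ?_
          field_simp
          ring
    _ = _ := by
        rw [integral_add ((hc _).mul hU).integrable (hc 4).integrable, integral_const_mul]
        simp

lemma integral_edge_new_le {t : ℕ} (ht : 1 ≤ t) (hp1 : p ≤ 1) :
    ∫ ω, P.vtx (t + 1) ω *
      (P.degR (t + 1) (P.ep (t + 1) ω).1 ω * P.degR (t + 1) (P.ep (t + 1) ω).2 ω) ∂P.μ ≤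
      ∫ ω, 1 / t * P.sqSum t ω ∂P.μ := by
  have ht0 : (0 : ℝ) < t := by exact_mod_cast ht
  have hd : ∀ u, P.BddAdapted t fun ω => P.degR t u ω := fun u =>
    bddAdapted_degR measurable_const
  refine integral_le_of_step ht (G := fun u ω => P.degR t u ω + 1) (H := fun _ _ _ => 0)
    (bddAdapted_edgeTerm le_rfl) ((BddAdapted.const t _).mul (bddAdapted_sqSum t))
    (fun u => (hd u).add (BddAdapted.const t 1)) (fun _ _ => BddAdapted.const t 0) ?_ ?_ ?_
  · intro ω hZ
    have h := P.ep_vertexStep t ht ω hZ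
    rw [degR_succ, degR_succ, degR_eq_zero (i := (P.ep (t + 1) ω).2) (by omega),
      if_neg (c := (P.ep (t + 1) ω).2 = (P.ep (t + 1) ω).1) (by omega),
      if_neg (c := (P.ep (t + 1) ω).1 = (P.ep (t + 1) ω).2) (by omega)]
    simp [vtx, hZ]
  · intro ω hZ
    simp [vtx, hZ]
  · intro ω
    rw [stepMean_eq]
    simp only [mul_zero, Finset.sum_const_zero, add_zero]
    have : ∑ u ∈ Finset.Icc 1 t, P.degR t u ω * (P.degR t u ω + 1) ≤ 2 * P.sqSum t ω := by
      unfold sqSum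
      rw [Finset.mul_sum]
      refine Finset.sum_le_sum fun u _ => ?_
      nlinarith [degR_le_sq t u ω]
    calc p / (2 * t) * ∑ u ∈ Finset.Icc 1 t, P.degR t u ω * (P.degR t u ω + 1)
        ≤ 1 / (2 * t) * (2 * P.sqSum t ω) := by
          gcongr
          exact Finset.sum_nonneg fun u _ => mul_nonneg (degR_nonneg _ _ _)
            (by linarith [degR_nonneg t u ω])
      _ = _ := by field_simp

lemma eq_true_of_vtx_ne_zero {s : ℕ} {ω : P.Ω} (h : P.vtx s ω ≠ 0) : P.Z s ω = true := by
  by_contra hZ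
  exact h (if_neg hZ)

lemma integral_edgeWeight_succ_le {t : ℕ} (ht : 1 ≤ t) (hp0 : 0 ≤ p) (hp1 : p ≤ 1) :
    ∫ ω, P.edgeWeight (t + 1) ω ∂P.μ ≤
      (1 + (2 - p) / t + 1 / (2 * t ^ 2)) * ∫ ω, P.edgeWeight t ω ∂P.μ
        + 1 / t * ∫ ω, P.sqSum t ω ∂P.μ := by
  have h1 : ∀ a ∈ Finset.Icc 2 t, P.BddAdapted (t + 1) fun ω => P.vtx a ω *
      (P.degR (t + 1) (P.ep a ω).1 ω * P.degR (t + 1) (P.ep a ω).2 ω) := fun a ha =>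
    bddAdapted_edgeTerm (by have := (Finset.mem_Icc.1 ha).2; omega)
  have h2 : ∀ a ∈ Finset.Icc 2 t, P.BddAdapted t fun ω => P.vtx a ω *
      (P.degR t (P.ep a ω).1 ω * P.degR t (P.ep a ω).2 ω) := fun a ha =>
    bddAdapted_edgeTerm (Finset.mem_Icc.1 ha).2
  have hsplit : ∀ ω, P.edgeWeight (t + 1) ω = (∑ a ∈ Finset.Icc 2 t, P.vtx a ω *
      (P.degR (t + 1) (P.ep a ω).1 ω * P.degR (t + 1) (P.ep a ω).2 ω)) + P.vtx (t + 1) ω *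
      (P.degR (t + 1) (P.ep (t + 1) ω).1 ω * P.degR (t + 1) (P.ep (t + 1) ω).2 ω) := fun ω =>
    Finset.sum_Icc_succ_top (by omega) _
  simp only [hsplit]
  rw [integral_add (BddAdapted.sum _ h1).integrable (bddAdapted_edgeTerm le_rfl).integrable,
    ← integral_const_mul, ← integral_const_mul]
  refine add_le_add ?_ (integral_edge_new_le ht hp1)
  unfold edgeWeight
  simp only [Finset.mul_sum]
  refine integral_sum_le _ h1 (fun a ha => (BddAdapted.const t _).mul (h2 a ha)) fun a ha => ?_
  have ha := Finset.mem_Icc.1 ha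
  refine integral_pair_step ht (bddAdapted_vtx ha.2) (measurable_ep ha.2).fst
    (measurable_ep ha.2).snd (fun ω => vtx_nonneg _ _) (fun ω h => ?_) hp0
  have hZ := eq_true_of_vtx_ne_zero h
  have h3 := ep_vertexStep' ha.1 hZ
  have h4 := nv_mono (P := P) (by omega) ha.2 ω
  omega

lemma sel_le_nv (c : Bool) {s : ℕ} (hs : 1 ≤ s) (ω : P.Ω) : sel c (P.ep s ω) ≤ P.nv s ω := by
  have := ep_le_nv (P := P) hs ω
  cases c <;> simp [sel] <;> omega

lemma sel_ne_sel_not (c : Bool) {s : ℕ} (hs : 2 ≤ s) {ω : P.Ω} (hZ : P.Z s ω = true) :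
    sel c (P.ep s ω) ≠ sel (!c) (P.ep s ω) := by
  have := ep_vertexStep' hs hZ
  cases c <;> simp [sel] <;> omega

lemma integral_path_new_le (c : Bool) {a t : ℕ} (ha : 2 ≤ a) (hat : a ≤ t)
    (hp1 : p ≤ 1) :
    ∫ ω, P.link c a (t + 1) ω * (P.degR (t + 1) (sel (!c) (P.ep a ω)) ω *
      P.degR (t + 1) (P.ep (t + 1) ω).2 ω) ∂P.μ ≤
      ∫ ω, 1 / t * (P.vtx a ω * (P.degR t (P.ep a ω).1 ω * P.degR t (P.ep a ω).2 ω)) ∂P.μ := by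
  have ht : 1 ≤ t := by omega
  have ht0 : (0 : ℝ) < t := by exact_mod_cast ht
  refine integral_le_of_step ht
    (G := fun u ω => P.vtx a ω * P.degR t (sel (!c) (P.ep a ω)) ω *
      (if u = sel c (P.ep a ω) then 1 else 0)) (H := fun _ _ _ => 0)
    (bddAdapted_pathTerm c (by omega) le_rfl)
    ((BddAdapted.const t _).mul (bddAdapted_edgeTerm hat))
    (fun u => ((bddAdapted_vtx hat).mul (bddAdapted_degR (measurable_sel _ hat))).mul
      (BddAdapted.indicator (measurableSet_eq_fun measurable_const (measurable_sel _ hat))))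
    (fun _ _ => BddAdapted.const t 0) ?_ ?_ ?_
  · intro ω hZ
    by_cases h0 : P.vtx a ω = 0
    · simp [link, h0]
    have hZa := eq_true_of_vtx_ne_zero h0
    have h := P.ep_vertexStep t ht ω hZ
    by_cases hl : (P.ep (t + 1) ω).1 = sel c (P.ep a ω)
    · have h1 := sel_ne_sel_not c ha hZa
      have h2 := sel_le_nv (P := P) (!c) (s := a) (by omega) ω
      have h3 := nv_mono (P := P) (by omega) hat ω
      rw [degR_succ, degR_succ, degR_eq_zero (i := (P.ep (t + 1) ω).2) (by omega),
        if_neg (c := (P.ep (t + 1) ω).1 = (P.ep (t + 1) ω).2) (by omega),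
        if_neg (c := (P.ep (t + 1) ω).1 = sel (!c) (P.ep a ω)) (by omega),
        if_neg (c := (P.ep (t + 1) ω).2 = sel (!c) (P.ep a ω)) (by omega)]
      simp [link, vtx, hZ, hl]
    · simp [link, hl]
  · intro ω hZ
    simp [link, vtx, hZ]
  · intro ω
    rw [stepMean_eq]
    simp only [mul_zero, Finset.sum_const_zero, add_zero]
    simp only [mul_left_comm (P.degR t _ ω) (P.vtx a ω * _), ← Finset.mul_sum,
      sum_degR_mul_ite ht]
    have hs : P.degR t (sel (!c) (P.ep a ω)) ω * P.degR t (sel c (P.ep a ω)) ω =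
        P.degR t (P.ep a ω).1 ω * P.degR t (P.ep a ω).2 ω := by
      cases c <;> simp [sel, mul_comm]
    rw [mul_assoc, hs]
    refine mul_le_mul_of_nonneg_right ?_ (mul_nonneg (vtx_nonneg _ _)
      (mul_nonneg (degR_nonneg _ _ _) (degR_nonneg _ _ _)))
    gcongr
    linarith

lemma link_ne_zero {c : Bool} {a b : ℕ} {ω : P.Ω} (h : P.link c a b ω ≠ 0) :
    P.Z a ω = true ∧ P.Z b ω = true := by
  unfold link at h
  exact ⟨eq_true_of_vtx_ne_zero (left_ne_zero_of_mul (left_ne_zero_of_mul h)),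
    eq_true_of_vtx_ne_zero (right_ne_zero_of_mul (left_ne_zero_of_mul h))⟩

lemma integral_pathWeight_succ_le (c : Bool) {t : ℕ} (ht : 1 ≤ t) (hp0 : 0 ≤ p) (hp1 : p ≤ 1) :
    ∫ ω, P.pathWeight c (t + 1) ω ∂P.μ ≤
      (1 + (2 - p) / t + 1 / (2 * t ^ 2)) * ∫ ω, P.pathWeight c t ω ∂P.μ
        + 1 / t * ∫ ω, P.edgeWeight t ω ∂P.μ := by
  have hI : Finset.Ico 2 (t + 1) = Finset.Icc 2 t := by ext; simp
  have h1 : ∀ b ∈ Finset.Icc 2 t, ∀ a ∈ Finset.Ico 2 b, P.BddAdapted (t + 1) fun ω =>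
      P.link c a b ω *
        (P.degR (t + 1) (sel (!c) (P.ep a ω)) ω * P.degR (t + 1) (P.ep b ω).2 ω) := by
    intro b hb a ha
    have hb := Finset.mem_Icc.1 hb
    have ha := Finset.mem_Ico.1 ha
    exact bddAdapted_pathTerm c (by omega) (by omega)
  have h2 : ∀ a ∈ Finset.Icc 2 t, P.BddAdapted (t + 1) fun ω => P.link c a (t + 1) ω *
      (P.degR (t + 1) (sel (!c) (P.ep a ω)) ω * P.degR (t + 1) (P.ep (t + 1) ω).2 ω) :=
    fun a ha => bddAdapted_pathTerm c (by have := Finset.mem_Icc.1 ha; omega) le_rfl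
  have h3 : ∀ b ∈ Finset.Icc 2 t, ∀ a ∈ Finset.Ico 2 b, P.BddAdapted t fun ω =>
      (1 + (2 - p) / t + 1 / (2 * t ^ 2)) * (P.link c a b ω *
        (P.degR t (sel (!c) (P.ep a ω)) ω * P.degR t (P.ep b ω).2 ω)) := by
    intro b hb a ha
    have hb := Finset.mem_Icc.1 hb
    have ha := Finset.mem_Ico.1 ha
    exact (BddAdapted.const t _).mul (bddAdapted_pathTerm c (by omega) (by omega))
  have h4 : ∀ a ∈ Finset.Icc 2 t, P.BddAdapted t fun ω => 1 / t * (P.vtx a ω *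
      (P.degR t (P.ep a ω).1 ω * P.degR t (P.ep a ω).2 ω)) := fun a ha =>
    (BddAdapted.const t _).mul (bddAdapted_edgeTerm (Finset.mem_Icc.1 ha).2)
  have hsplit : ∀ ω, P.pathWeight c (t + 1) ω = (∑ b ∈ Finset.Icc 2 t, ∑ a ∈ Finset.Ico 2 b,
      P.link c a b ω *
        (P.degR (t + 1) (sel (!c) (P.ep a ω)) ω * P.degR (t + 1) (P.ep b ω).2 ω)) +
      ∑ a ∈ Finset.Icc 2 t, P.link c a (t + 1) ω *
        (P.degR (t + 1) (sel (!c) (P.ep a ω)) ω * P.degR (t + 1) (P.ep (t + 1) ω).2 ω) := by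
    intro ω
    rw [← hI]
    exact Finset.sum_Icc_succ_top (by omega) _
  simp only [hsplit]
  rw [integral_add (BddAdapted.sum _ fun b hb => BddAdapted.sum _ (h1 b hb)).integrable
    (BddAdapted.sum _ h2).integrable, ← integral_const_mul, ← integral_const_mul]
  unfold pathWeight edgeWeight
  simp only [Finset.mul_sum]
  refine add_le_add ?_ (integral_sum_le _ h2 h4 fun a ha => ?_)
  · refine integral_sum_le _ (fun b hb => BddAdapted.sum _ (h1 b hb))
      (fun b hb => BddAdapted.sum _ (h3 b hb)) fun b hb =>
        integral_sum_le _ (h1 b hb) (h3 b hb) fun a ha => ?_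
    have hb := Finset.mem_Icc.1 hb
    have ha := Finset.mem_Ico.1 ha
    refine integral_pair_step ht (bddAdapted_link c (by omega) hb.2)
      (measurable_sel (!c) (by omega)) (measurable_ep hb.2).snd (fun ω => link_nonneg _ _ _ _)
      (fun ω h => ?_) hp0
    have hZ := link_ne_zero h
    have h5 := ep_vertexStep' hb.1 hZ.2
    have h6 := nv_mono (P := P) (by omega) hb.2 ω
    have h7 := nv_mono (P := P) (s := a) (t := b - 1) (by omega) (by omega) ω
    have h8 := sel_le_nv (P := P) (!c) (s := a) (by omega) ω
    omega
  · have ha := Finset.mem_Icc.1 ha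
    exact integral_path_new_le c ha.1 ha.2 hp1

lemma integral_closing_succ_le (c : Bool) {t : ℕ} (ht : 1 ≤ t) (hp0 : 0 ≤ p) :
    ∫ ω, P.closing c (t + 1) ω ∂P.μ ≤ 1 / t ^ 2 * ∫ ω, P.pathWeight c t ω ∂P.μ := by
  have ht0 : (0 : ℝ) < t := by exact_mod_cast ht
  have hI : Finset.Ico 2 (t + 1) = Finset.Icc 2 t := by ext; simp
  have h1 : ∀ b ∈ Finset.Icc 2 t, ∀ a ∈ Finset.Ico 2 b, P.BddAdapted (t + 1) fun ω =>
      P.link c a b ω * ((1 - P.vtx (t + 1) ω) *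
        P.hit (t + 1) (sel (!c) (P.ep a ω)) (P.ep b ω).2 ω) := by
    intro b hb a ha
    have hb := Finset.mem_Icc.1 hb
    have ha := Finset.mem_Ico.1 ha
    exact bddAdapted_closingTerm c (by omega) (by omega)
  have h3 : ∀ b ∈ Finset.Icc 2 t, ∀ a ∈ Finset.Ico 2 b, P.BddAdapted t fun ω =>
      1 / t ^ 2 * (P.link c a b ω *
        (P.degR t (sel (!c) (P.ep a ω)) ω * P.degR t (P.ep b ω).2 ω)) := by
    intro b hb a ha
    have hb := Finset.mem_Icc.1 hb
    have ha := Finset.mem_Ico.1 ha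
    exact (BddAdapted.const t _).mul (bddAdapted_pathTerm c (by omega) (by omega))
  rw [← integral_const_mul]
  unfold closing pathWeight
  simp only [Finset.mul_sum, hI]
  refine integral_sum_le _ (fun b hb => BddAdapted.sum _ (h1 b hb))
    (fun b hb => BddAdapted.sum _ (h3 b hb)) fun b hb =>
      integral_sum_le _ (h1 b hb) (h3 b hb) fun a ha => ?_
  have hb' := Finset.mem_Icc.1 hb
  have ha' := Finset.mem_Ico.1 ha
  have hl := bddAdapted_link (P := P) c (a := a) (b := b) (t := t) (by omega) hb'.2
  have hx := measurable_sel (P := P) (!c) (s := a) (t := t) (by omega)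
  have hy := (measurable_ep (P := P) hb'.2).snd
  have hi : ∀ u, P.BddAdapted t fun ω => if u = sel (!c) (P.ep a ω) then 1 else 0 := fun u =>
    BddAdapted.indicator (measurableSet_eq_fun measurable_const hx)
  have hj : ∀ u, P.BddAdapted t fun ω => if u = (P.ep b ω).2 then 1 else 0 := fun u =>
    BddAdapted.indicator (measurableSet_eq_fun measurable_const hy)
  refine integral_le_of_step ht (G := fun _ _ => 0)
    (H := fun u w ω => P.link c a b ω *
      ((if u = sel (!c) (P.ep a ω) then 1 else 0) * (if w = (P.ep b ω).2 then 1 else 0)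
        + (if u = (P.ep b ω).2 then 1 else 0) * (if w = sel (!c) (P.ep a ω) then 1 else 0)))
    (h1 b hb a ha) (h3 b hb a ha) (fun _ => BddAdapted.const t 0)
    (fun u w => hl.mul (((hi u).mul (hj w)).add ((hj u).mul (hi w)))) ?_ ?_ ?_
  · intro ω hZ
    simp [vtx, hZ]
  · intro ω hZ
    refine mul_le_mul_of_nonneg_left (le_of_eq ?_) (link_nonneg _ _ _ _)
    simp only [vtx, hZ, hit, Prod.ext_iff, Bool.false_eq_true, if_false, sub_zero, one_mul,
      ite_and, mul_ite, mul_one, mul_zero]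
    congr 1 <;> split_ifs <;> rfl
  · intro ω
    rw [stepMean_eq]
    simp only [mul_zero, Finset.sum_const_zero, zero_add]
    have hw : ∀ u, ∑ w ∈ Finset.Icc 1 t, P.degR t w ω * (P.link c a b ω *
        ((if u = sel (!c) (P.ep a ω) then 1 else 0) * (if w = (P.ep b ω).2 then 1 else 0)
        + (if u = (P.ep b ω).2 then 1 else 0) * (if w = sel (!c) (P.ep a ω) then 1 else 0))) =
        0 + P.link c a b ω * P.degR t (P.ep b ω).2 ω *
          (if u = sel (!c) (P.ep a ω) then 1 else 0)
        + P.link c a b ω * P.degR t (sel (!c) (P.ep a ω)) ω *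
          (if u = (P.ep b ω).2 then 1 else 0) := by
      intro u
      rw [← sum_degR_mul_ite ht (P.ep b ω).2, ← sum_degR_mul_ite ht (sel (!c) (P.ep a ω))]
      simp only [zero_add, Finset.mul_sum, Finset.sum_mul, ← Finset.sum_add_distrib]
      exact Finset.sum_congr rfl fun w _ => by ring
    simp only [hw, sum_degR_affine ht]
    have hD : 0 ≤ P.link c a b ω *
        (P.degR t (sel (!c) (P.ep a ω)) ω * P.degR t (P.ep b ω).2 ω) :=
      mul_nonneg (link_nonneg _ _ _ _) (mul_nonneg (degR_nonneg _ _ _) (degR_nonneg _ _ _))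
    calc _ = (1 - p) / (2 * t ^ 2) * (P.link c a b ω *
          (P.degR t (sel (!c) (P.ep a ω)) ω * P.degR t (P.ep b ω).2 ω)) := by
          field_simp; ring
      _ ≤ _ := by
          refine mul_le_mul_of_nonneg_right ?_ hD
          rw [div_le_div_iff₀ (by positivity) (by positivity)]
          nlinarith [mul_nonneg hp0 (sq_nonneg (t : ℝ)), sq_nonneg (t : ℝ)]

lemma nv_lt_iff_of_vertexStep {a b : ℕ} (ha : 2 ≤ a) (hb : 2 ≤ b) {ω : P.Ω}
    (hZa : P.Z a ω = true) (hZb : P.Z b ω = true) : P.nv a ω < P.nv b ω ↔ a < b := by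
  have h1 := ep_vertexStep' ha hZa
  have h2 := ep_vertexStep' hb hZb
  constructor
  · intro h
    by_contra hab
    have := nv_mono (P := P) (by omega) (not_lt.1 hab) ω
    omega
  · intro h
    have := nv_mono (P := P) (s := a) (t := b - 1) (by omega) (by omega) ω
    omega

lemma VJoined.exists_step {t i j : ℕ} {ω : P.Ω} (h : P.VJoined t i j ω) (hij : i < j) :
    ∃ a, 2 ≤ a ∧ a ≤ t ∧ P.Z a ω = true ∧ P.ep a ω = (i, j) ∧ P.nv a ω = j := by
  obtain ⟨a, ha, ha2, hZ, he⟩ := h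
  have h1 := ep_vertexStep' ha2 hZ
  refine ⟨a, ha2, (Finset.mem_Icc.1 ha).2, hZ, ?_⟩
  rcases he with he | he <;> rw [he] at h1 ⊢
  · exact ⟨rfl, h1.1.symm⟩
  · simp only at h1
    omega

lemma EdgeJoined.exists_step {t i k : ℕ} {ω : P.Ω} (h : P.EdgeJoined t i k ω) :
    ∃ s, 2 ≤ s ∧ s ≤ t ∧ P.Z s ω = false ∧ (P.ep s ω = (i, k) ∨ P.ep s ω = (k, i)) ∧
      k ≤ P.nv (s - 1) ω := by
  obtain ⟨s, hs, hs2, hZ, he⟩ := h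
  refine ⟨s, hs2, (Finset.mem_Icc.1 hs).2, hZ, he, ?_⟩
  obtain ⟨r, rfl⟩ : ∃ r, s = r + 1 := ⟨s - 1, by omega⟩
  have h1 := P.ep_edgeStep r (by omega) ω hZ
  rcases he with he | he <;> rw [he] at h1 <;> simp_all

/-- A triangle with exactly one edge-step edge among two vertex-step edges arises by closing a
path of two vertex-step edges. -/
lemma exists_closing_steps {t i j k : ℕ} {ω : P.Ω} (hij : i < j) (hjk : j < k)
    (h : (P.EdgeJoined t i j ω ∧ P.VJoined t i k ω ∧ P.VJoined t j k ω) ∨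
      (P.VJoined t i j ω ∧ P.EdgeJoined t i k ω ∧ P.VJoined t j k ω) ∨
      (P.VJoined t i j ω ∧ P.VJoined t i k ω ∧ P.EdgeJoined t j k ω)) :
    ∃ s ∈ Finset.Icc 2 t, ∃ b ∈ Finset.Ico 2 s, ∃ a ∈ Finset.Ico 2 b,
      P.Z a ω = true ∧ P.Z b ω = true ∧ P.Z s ω = false ∧
      (i, j, k) = ((P.ep a ω).1, (P.ep a ω).2, (P.ep b ω).2) ∧
      ∃ c, (P.ep b ω).1 = sel c (P.ep a ω) ∧
        (P.ep s ω = (sel (!c) (P.ep a ω), (P.ep b ω).2) ∨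
          P.ep s ω = ((P.ep b ω).2, sel (!c) (P.ep a ω))) := by
  have before : ∀ {b s}, P.nv b ω = k → P.Z b ω = true → 2 ≤ b → 2 ≤ s →
      k ≤ P.nv (s - 1) ω → b < s := by
    intro b s hb hZ hb2 hs2 hs
    by_contra hbs
    have h1 := ep_vertexStep' hb2 hZ
    have h2 := nv_mono (P := P) (s := s - 1) (t := b - 1) (by omega) (by omega) ω
    omega
  rcases h with ⟨-, h1, h2⟩ | ⟨h1, h3, h2⟩ | ⟨h1, h2, h3⟩
  · obtain ⟨a, ha, -, hZa, hea, hna⟩ := h1.exists_step (by omega)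
    obtain ⟨b, hb, -, hZb, heb, hnb⟩ := h2.exists_step hjk
    have h3 := nv_lt_iff_of_vertexStep ha hb hZa hZb
    have h4 := nv_lt_iff_of_vertexStep hb ha hZb hZa
    have : a = b := by omega
    subst this
    rw [hea, Prod.mk.injEq] at heb
    omega
  · obtain ⟨a, ha, -, hZa, hea, hna⟩ := h1.exists_step hij
    obtain ⟨b, hb, -, hZb, heb, hnb⟩ := h2.exists_step hjk
    obtain ⟨s, hs, hst, hZs, hes, hks⟩ := h3.exists_step
    have hab := (nv_lt_iff_of_vertexStep ha hb hZa hZb).1 (by omega)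
    refine ⟨s, Finset.mem_Icc.2 ⟨hs, hst⟩, b,
      Finset.mem_Ico.2 ⟨hb, before hnb hZb hb hs hks⟩, a, Finset.mem_Ico.2 ⟨ha, hab⟩,
      hZa, hZb, hZs, by rw [hea, heb], false, by simp [hea, heb, sel], ?_⟩
    simpa [hea, heb, sel] using hes
  · obtain ⟨a, ha, -, hZa, hea, hna⟩ := h1.exists_step hij
    obtain ⟨b, hb, -, hZb, heb, hnb⟩ := h2.exists_step (by omega)
    obtain ⟨s, hs, hst, hZs, hes, hks⟩ := h3.exists_step
    have hab := (nv_lt_iff_of_vertexStep ha hb hZa hZb).1 (by omega)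
    refine ⟨s, Finset.mem_Icc.2 ⟨hs, hst⟩, b,
      Finset.mem_Ico.2 ⟨hb, before hnb hZb hb hs hks⟩, a, Finset.mem_Ico.2 ⟨ha, hab⟩,
      hZa, hZb, hZs, by rw [hea, heb], true, by simp [hea, heb, sel], ?_⟩
    simpa [hea, heb, sel] using hes

lemma card_le_sum_closing {t : ℕ} {ω : P.Ω} {S : Finset (ℕ × ℕ × ℕ)}
    (hS : ∀ q ∈ S, q.1 < q.2.1 ∧ q.2.1 < q.2.2 ∧
      ((P.EdgeJoined t q.1 q.2.1 ω ∧ P.VJoined t q.1 q.2.2 ω ∧ P.VJoined t q.2.1 q.2.2 ω) ∨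
        (P.VJoined t q.1 q.2.1 ω ∧ P.EdgeJoined t q.1 q.2.2 ω ∧ P.VJoined t q.2.1 q.2.2 ω) ∨
        (P.VJoined t q.1 q.2.1 ω ∧ P.VJoined t q.1 q.2.2 ω ∧
          P.EdgeJoined t q.2.1 q.2.2 ω))) :
    (S.card : ℝ) ≤ ∑ s ∈ Finset.Icc 2 t, (P.closing true s ω + P.closing false s ω) := by
  let Q : ℕ → ℕ → ℕ → Prop := fun s b a =>
    P.Z a ω = true ∧ P.Z b ω = true ∧ P.Z s ω = false ∧
      ∃ c, (P.ep b ω).1 = sel c (P.ep a ω) ∧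
        (P.ep s ω = (sel (!c) (P.ep a ω), (P.ep b ω).2) ∨
          P.ep s ω = ((P.ep b ω).2, sel (!c) (P.ep a ω)))
  let B : ℕ → ℕ → ℕ → Finset (ℕ × ℕ × ℕ) := fun s b a =>
    if Q s b a then {((P.ep a ω).1, (P.ep a ω).2, (P.ep b ω).2)} else ∅
  have hsub : S ⊆ (Finset.Icc 2 t).biUnion fun s => (Finset.Ico 2 s).biUnion fun b =>
      (Finset.Ico 2 b).biUnion fun a => B s b a := by
    intro q hq
    obtain ⟨h1, h2, h3⟩ := hS q hq
    obtain ⟨s, hs, b, hb, a, ha, hZa, hZb, hZs, he, hc⟩ := exists_closing_steps h1 h2 h3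
    simp only [Finset.mem_biUnion]
    refine ⟨s, hs, b, hb, a, ha, ?_⟩
    have hQ : Q s b a := ⟨hZa, hZb, hZs, hc⟩
    simpa only [B, if_pos hQ, Finset.mem_singleton] using he
  have hcard : S.card ≤ ∑ s ∈ Finset.Icc 2 t, ∑ b ∈ Finset.Ico 2 s, ∑ a ∈ Finset.Ico 2 b,
      (B s b a).card :=
    (Finset.card_le_card hsub).trans <| Finset.card_biUnion_le.trans <|
      Finset.sum_le_sum fun s _ => Finset.card_biUnion_le.trans <|
        Finset.sum_le_sum fun b _ => Finset.card_biUnion_le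
  calc (S.card : ℝ) ≤ ((∑ s ∈ Finset.Icc 2 t, ∑ b ∈ Finset.Ico 2 s, ∑ a ∈ Finset.Ico 2 b,
        (B s b a).card : ℕ) : ℝ) := by exact_mod_cast hcard
    _ ≤ _ := by
      unfold closing
      push_cast
      simp only [← Finset.sum_add_distrib]
      refine Finset.sum_le_sum fun s _ => Finset.sum_le_sum fun b _ =>
        Finset.sum_le_sum fun a _ => ?_
      have hnn : ∀ c, 0 ≤ P.link c a b ω *
          ((1 - P.vtx s ω) * P.hit s (sel (!c) (P.ep a ω)) (P.ep b ω).2 ω) := fun c =>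
        mul_nonneg (link_nonneg _ _ _ _)
          (mul_nonneg (sub_nonneg.2 (vtx_le_one _ _)) (hit_nonneg _ _ _ _))
      by_cases hQ : Q s b a
      · have hone : ∃ c, 1 ≤ P.link c a b ω *
            ((1 - P.vtx s ω) * P.hit s (sel (!c) (P.ep a ω)) (P.ep b ω).2 ω) := by
          obtain ⟨hZa, hZb, hZs, c, hc, he⟩ := hQ
          refine ⟨c, ?_⟩
          have hh : 1 ≤ P.hit s (sel (!c) (P.ep a ω)) (P.ep b ω).2 ω := by
            unfold hit
            rcases he with he | he
            · rw [if_pos he]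
              split_ifs <;> norm_num
            · rw [if_pos (c := P.ep s ω = ((P.ep b ω).2, sel (!c) (P.ep a ω))) he]
              split_ifs <;> norm_num
          simpa [link, vtx, hZa, hZb, hZs, hc] using hh
        have hB : ((B s b a).card : ℝ) = 1 := by simp [B, hQ]
        rw [hB]
        obtain ⟨c, hc⟩ := hone
        have h1 := hnn true
        have h2 := hnn false
        cases c <;> linarith
      · have hB : ((B s b a).card : ℝ) = 0 := by simp [B, hQ]
        rw [hB]
        exact add_nonneg (hnn true) (hnn false)

end

end PAProcess

lemma one_le_harmonic {t : ℕ} (ht : 1 ≤ t) : (1 : ℝ) ≤ (harmonic t : ℝ) := by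
  induction t, ht using Nat.le_induction with
  | base => simp [harmonic]
  | succ n _ ih =>
    rw [harmonic_succ]
    push_cast
    have : (0 : ℝ) ≤ ((n : ℝ) + 1)⁻¹ := by positivity
    linarith

lemma harmonic_le_harmonic_succ (t : ℕ) : (harmonic t : ℝ) ≤ (harmonic (t + 1) : ℝ) := by
  rw [harmonic_succ]
  push_cast
  have : (0 : ℝ) ≤ ((t : ℝ) + 1)⁻¹ := by positivity
  linarith

/-- A discrete Grönwall inequality at the critical polynomial rate. -/
lemma le_rpow_mul_harmonic_of_succ_le {c K : ℝ} (hc : 1 ≤ c) (hK : 0 ≤ K) {m : ℕ} {x : ℕ → ℝ}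
    (hx0 : 0 ≤ x 1)
    (hx : ∀ t : ℕ, 1 ≤ t → x (t + 1) ≤ (1 + c / t + 1 / (2 * t ^ 2)) * x t
      + K * (t : ℝ) ^ (c - 1) * (harmonic t : ℝ) ^ m) {t : ℕ} (ht : 1 ≤ t) :
    x t ≤ 4 * (x 1 + K) * (t : ℝ) ^ c * (harmonic t : ℝ) ^ (m + 1) := by
  have key : x t ≤ (t : ℝ) ^ c * ((t : ℝ) / (t + 1)) ^ 2 *
      (4 * x 1 + 4 * K * (harmonic t : ℝ) ^ (m + 1)) := by
    induction t, ht using Nat.le_induction with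
    | base =>
      simp [harmonic]
      linarith
    | succ n hn ih =>
      have hn1 : (1 : ℝ) ≤ n := by exact_mod_cast hn
      have hn0 : (0 : ℝ) < n := by linarith
      have hH := one_le_harmonic hn
      have hH' := harmonic_le_harmonic_succ n
      have hHs : (harmonic (n + 1) : ℝ) = harmonic n + ((n : ℝ) + 1)⁻¹ := by
        rw [harmonic_succ]; push_cast; rfl
      push_cast
      set h : ℝ := (harmonic n : ℝ) with hh
      set h' : ℝ := (harmonic (n + 1) : ℝ) with hh'
      have hnc : (0 : ℝ) < (n : ℝ) ^ c := Real.rpow_pos_of_pos hn0 c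
      have hrate : (n : ℝ) ^ c * (1 + c / n) ≤ ((n : ℝ) + 1) ^ c := by
        have h1 : ((n : ℝ) + 1) = n * (1 + 1 / n) := by field_simp
        rw [h1, Real.mul_rpow hn0.le (by positivity)]
        refine mul_le_mul_of_nonneg_left ?_ hnc.le
        have := one_add_mul_self_le_rpow_one_add (s := 1 / (n : ℝ))
          (by have : (0 : ℝ) ≤ 1 / n := by positivity
              linarith) hc
        calc 1 + c / n = 1 + c * (1 / n) := by ring
          _ ≤ _ := this
      have hsq : ((n : ℝ) / (n + 1)) ^ 2 * (1 + 1 / (2 * n ^ 2)) ≤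
          (((n : ℝ) + 1) / (n + 1 + 1)) ^ 2 := by
        have : ((n : ℝ) / (n + 1)) ^ 2 * (1 + 1 / (2 * n ^ 2)) =
            (2 * n ^ 2 + 1) / (2 * (n + 1) ^ 2) := by field_simp
        rw [this, div_pow, div_le_div_iff₀ (by positivity) (by positivity)]
        nlinarith [mul_pos hn0 hn0]
      have hmain : (1 + c / n + 1 / (2 * n ^ 2)) * ((n : ℝ) ^ c * ((n : ℝ) / (n + 1)) ^ 2) ≤
          ((n : ℝ) + 1) ^ c * (((n : ℝ) + 1) / (n + 1 + 1)) ^ 2 := by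
        calc (1 + c / n + 1 / (2 * n ^ 2)) * ((n : ℝ) ^ c * ((n : ℝ) / (n + 1)) ^ 2)
            ≤ ((1 + c / n) * (1 + 1 / (2 * n ^ 2))) *
              ((n : ℝ) ^ c * ((n : ℝ) / (n + 1)) ^ 2) := by
              refine mul_le_mul_of_nonneg_right ?_ (by positivity)
              have : 0 ≤ c / n * (1 / (2 * (n : ℝ) ^ 2)) := by positivity
              nlinarith
          _ = ((n : ℝ) ^ c * (1 + c / n)) *
              (((n : ℝ) / (n + 1)) ^ 2 * (1 + 1 / (2 * n ^ 2))) := by ring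
          _ ≤ _ := mul_le_mul hrate hsq (by positivity) (by positivity)
      have hnew : (n : ℝ) ^ (c - 1) ≤
          ((n : ℝ) + 1) ^ c * (((n : ℝ) + 1) / (n + 1 + 1)) ^ 2 * (4 * ((n : ℝ) + 1)⁻¹) := by
        have h1 : (n : ℝ) ^ (c - 1) ≤ ((n : ℝ) + 1) ^ (c - 1) :=
          Real.rpow_le_rpow hn0.le (by linarith) (by linarith)
        have h2 : ((n : ℝ) + 1) ^ (c - 1) = ((n : ℝ) + 1) ^ c * ((n : ℝ) + 1)⁻¹ := by
          rw [Real.rpow_sub_one (by positivity), div_eq_mul_inv]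
        have h3 : 1 ≤ 4 * (((n : ℝ) + 1) / (n + 1 + 1)) ^ 2 := by
          rw [div_pow, mul_div_assoc', le_div_iff₀ (by positivity)]
          nlinarith
        calc (n : ℝ) ^ (c - 1) ≤ ((n : ℝ) + 1) ^ c * ((n : ℝ) + 1)⁻¹ * 1 := by
              rw [mul_one]; exact h1.trans h2.le
          _ ≤ ((n : ℝ) + 1) ^ c * ((n : ℝ) + 1)⁻¹ * (4 * (((n : ℝ) + 1) / (n + 1 + 1)) ^ 2) :=
              mul_le_mul_of_nonneg_left h3 (by positivity)
          _ = _ := by ring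
      have hpow : h ^ (m + 1) + h ^ m * ((n : ℝ) + 1)⁻¹ ≤ h' ^ (m + 1) := by
        have hh0 : 0 ≤ h' := by linarith
        calc h ^ (m + 1) + h ^ m * ((n : ℝ) + 1)⁻¹ = h ^ m * h' := by rw [hHs]; ring
          _ ≤ h' ^ m * h' := by gcongr
          _ = h' ^ (m + 1) := by ring
      set β := (n : ℝ) ^ c * ((n : ℝ) / (n + 1)) ^ 2
      set β' := ((n : ℝ) + 1) ^ c * (((n : ℝ) + 1) / (n + 1 + 1)) ^ 2
      have hβ' : 0 ≤ β' := by positivity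
      calc x (n + 1) ≤ (1 + c / n + 1 / (2 * n ^ 2)) * x n + K * (n : ℝ) ^ (c - 1) * h ^ m :=
            hx n hn
        _ ≤ (1 + c / n + 1 / (2 * n ^ 2)) * (β * (4 * x 1 + 4 * K * h ^ (m + 1)))
            + K * (β' * (4 * ((n : ℝ) + 1)⁻¹)) * h ^ m := by gcongr
        _ = ((1 + c / n + 1 / (2 * n ^ 2)) * β) * (4 * x 1 + 4 * K * h ^ (m + 1))
            + K * (β' * (4 * ((n : ℝ) + 1)⁻¹)) * h ^ m := by ring
        _ ≤ β' * (4 * x 1 + 4 * K * h ^ (m + 1))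
            + K * (β' * (4 * ((n : ℝ) + 1)⁻¹)) * h ^ m := by gcongr
        _ = β' * (4 * x 1 + 4 * K * (h ^ (m + 1) + h ^ m * ((n : ℝ) + 1)⁻¹)) := by ring
        _ ≤ β' * (4 * x 1 + 4 * K * h' ^ (m + 1)) := by gcongr
  have hH := one_le_harmonic ht
  have hHm : (1 : ℝ) ≤ (harmonic t : ℝ) ^ (m + 1) := one_le_pow₀ hH
  have hfrac : ((t : ℝ) / (t + 1)) ^ 2 ≤ 1 :=
    pow_le_one₀ (by positivity) (div_le_one_of_le₀ (by linarith) (by positivity))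
  calc x t ≤ _ := key
    _ ≤ (t : ℝ) ^ c * 1 * (4 * x 1 * (harmonic t : ℝ) ^ (m + 1)
        + 4 * K * (harmonic t : ℝ) ^ (m + 1)) := by
        have h1 : 4 * x 1 ≤ 4 * x 1 * (harmonic t : ℝ) ^ (m + 1) :=
          le_mul_of_one_le_right (by positivity) hHm
        refine mul_le_mul (mul_le_mul_of_nonneg_left hfrac (by positivity)) (by linarith)
          (by positivity) (by positivity)
    _ = _ := by ring

lemma rpow_add_rpow_sub_one_le {q : ℝ} (hq0 : 0 < q) (hq1 : q ≤ 1) {t : ℝ} (ht : 1 ≤ t) :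
    t ^ q + q / 2 * t ^ (q - 1) ≤ (t + 1) ^ q := by
  have ht0 : 0 < t := by linarith
  have h1 : t ^ q ≤ (t + 1) ^ q * (1 - q / (t + 1)) := by
    have h := rpow_one_add_le_one_add_mul_self (s := -(1 / (t + 1))) (p := q) (by
      rw [neg_le_neg_iff, div_le_one (by positivity)]; linarith) hq0.le hq1
    have e : t = (t + 1) * (1 + -(1 / (t + 1))) := by field_simp; ring
    calc t ^ q = (t + 1) ^ q * (1 + -(1 / (t + 1))) ^ q := by
          rw [← Real.mul_rpow (by positivity), ← e]
          have : 1 + -(1 / (t + 1)) = t / (t + 1) := by field_simp; ring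
          rw [this]; positivity
      _ ≤ (t + 1) ^ q * (1 + q * -(1 / (t + 1))) := by gcongr
      _ = _ := by ring
  have h2 : t ^ (q - 1) ≤ 2 * (t + 1) ^ (q - 1) := by
    have h3 : (2 * t) ^ (q - 1) ≤ (t + 1) ^ (q - 1) :=
      Real.rpow_le_rpow_of_nonpos (by positivity) (by linarith) (by linarith)
    rw [Real.mul_rpow (by norm_num) ht0.le] at h3
    have h4 : (1 / 2 : ℝ) ≤ 2 ^ (q - 1) := by
      rw [one_div, ← Real.rpow_neg_one]
      exact Real.rpow_le_rpow_of_exponent_le (by norm_num) (by linarith)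
    have h5 : 1 / 2 * t ^ (q - 1) ≤ 2 ^ (q - 1) * t ^ (q - 1) := by gcongr
    linarith
  have h6 : (t + 1) ^ (q - 1) = (t + 1) ^ q / (t + 1) := Real.rpow_sub_one (by positivity) q
  calc t ^ q + q / 2 * t ^ (q - 1)
      ≤ (t + 1) ^ q * (1 - q / (t + 1)) + q / 2 * (2 * (t + 1) ^ (q - 1)) := by gcongr
    _ = (t + 1) ^ q := by rw [h6]; ring

namespace PAProcess

attribute [local instance] PAProcess.m0 PAProcess.isProb

variable {p : ℝ} (P : PAProcess p)

lemma edgeWeight_nonneg (t : ℕ) (ω : P.Ω) : 0 ≤ P.edgeWeight t ω :=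
  Finset.sum_nonneg fun _ _ => mul_nonneg (vtx_nonneg _ _)
    (mul_nonneg (degR_nonneg _ _ _) (degR_nonneg _ _ _))

lemma pathWeight_nonneg (c : Bool) (t : ℕ) (ω : P.Ω) : 0 ≤ P.pathWeight c t ω :=
  Finset.sum_nonneg fun _ _ => Finset.sum_nonneg fun _ _ => mul_nonneg (link_nonneg _ _ _ _)
    (mul_nonneg (degR_nonneg _ _ _) (degR_nonneg _ _ _))

lemma exists_integral_pathWeight_le (c : Bool) (hp0 : 0 ≤ p) (hp1 : p ≤ 1) :
    ∃ K : ℝ, 0 ≤ K ∧ ∀ t : ℕ, 1 ≤ t →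
      ∫ ω, P.pathWeight c t ω ∂P.μ ≤ K * (t : ℝ) ^ (2 - p) * (harmonic t : ℝ) ^ 3 := by
  have hc : (1 : ℝ) ≤ 2 - p := by linarith
  have hU0 : ∀ t, 0 ≤ ∫ ω, P.sqSum t ω ∂P.μ := fun t => integral_nonneg (sqSum_nonneg t)
  have hV0 : ∀ t, 0 ≤ ∫ ω, P.edgeWeight t ω ∂P.μ := fun t =>
    integral_nonneg (P.edgeWeight_nonneg t)
  have hW0 : ∀ t, 0 ≤ ∫ ω, P.pathWeight c t ω ∂P.μ := fun t =>
    integral_nonneg (P.pathWeight_nonneg c t)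
  have hlift : ∀ (K y h : ℝ) (t : ℕ), 1 ≤ t → y ≤ K * (t : ℝ) ^ (2 - p) * h →
      1 / t * y ≤ K * (t : ℝ) ^ (2 - p - 1) * h := by
    intro K y h t ht hy
    have ht0 : (0 : ℝ) < t := by exact_mod_cast ht
    calc 1 / t * y ≤ 1 / t * (K * (t : ℝ) ^ (2 - p) * h) := by gcongr
      _ = _ := by rw [Real.rpow_sub_one ht0.ne']; ring
  have hU := fun {t : ℕ} => le_rpow_mul_harmonic_of_succ_le hc (K := 4) (by norm_num) (m := 0)
    (x := fun t => ∫ ω, P.sqSum t ω ∂P.μ) (hU0 1) (fun t ht => by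
      have ht1 : (1 : ℝ) ≤ t := by exact_mod_cast ht
      have h1 : (1 : ℝ) ≤ (t : ℝ) ^ (2 - p - 1) := Real.one_le_rpow ht1 (by linarith)
      have h2 : 0 ≤ 1 / (2 * (t : ℝ) ^ 2) * ∫ ω, P.sqSum t ω ∂P.μ :=
        mul_nonneg (by positivity) (hU0 t)
      have := integral_sqSum_succ_le (P := P) ht
      simp only [pow_zero, mul_one]
      linarith) (t := t)
  have hK1 : 0 ≤ 4 * ((∫ ω, P.sqSum 1 ω ∂P.μ) + 4) := by have := hU0 1; positivity
  have hV := fun {t : ℕ} => le_rpow_mul_harmonic_of_succ_le hc hK1 (m := 1)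
    (x := fun t => ∫ ω, P.edgeWeight t ω ∂P.μ) (hV0 1) (fun t ht =>
      (integral_edgeWeight_succ_le ht hp0 hp1).trans
        (add_le_add le_rfl (hlift _ _ _ t ht (hU ht)))) (t := t)
  have hK2 : 0 ≤ 4 * ((∫ ω, P.edgeWeight 1 ω ∂P.μ) + 4 * ((∫ ω, P.sqSum 1 ω ∂P.μ) + 4)) := by
    have := hV0 1
    positivity
  refine ⟨_, ?_, fun t ht => le_rpow_mul_harmonic_of_succ_le hc hK2 (m := 2)
    (x := fun t => ∫ ω, P.pathWeight c t ω ∂P.μ) (hW0 1) (fun t ht =>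
      (integral_pathWeight_succ_le c ht hp0 hp1).trans
        (add_le_add le_rfl (hlift _ _ _ t ht (hV ht)))) ht⟩
  have := hW0 1
  positivity

lemma exists_sum_integral_closing_le (c : Bool) (hp0 : 0 ≤ p) (hp1 : p < 1) :
    ∃ K : ℝ, 0 ≤ K ∧ ∀ t : ℕ, 1 ≤ t → ∑ s ∈ Finset.Icc 2 t, ∫ ω, P.closing c s ω ∂P.μ ≤
      K * (t : ℝ) ^ (1 - p) * (harmonic t : ℝ) ^ 3 := by
  obtain ⟨K, hK, hW⟩ := P.exists_integral_pathWeight_le c hp0 hp1.le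
  have hq : 0 < 1 - p := by linarith
  refine ⟨K * (2 / (1 - p)), by positivity, fun t ht => ?_⟩
  induction t, ht using Nat.le_induction with
  | base =>
    simp [harmonic]
    positivity
  | succ n hn ih =>
    have hn1 : (1 : ℝ) ≤ n := by exact_mod_cast hn
    have hn0 : (0 : ℝ) < n := by linarith
    have hH := one_le_harmonic hn
    have hH' := harmonic_le_harmonic_succ n
    rw [Finset.sum_Icc_succ_top (by omega)]
    have h1 : ∫ ω, P.closing c (n + 1) ω ∂P.μ ≤
        K * (n : ℝ) ^ (1 - p - 1) * (harmonic n : ℝ) ^ 3 := by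
      refine (integral_closing_succ_le c hn hp0).trans ?_
      calc 1 / (n : ℝ) ^ 2 * ∫ ω, P.pathWeight c n ω ∂P.μ
          ≤ 1 / (n : ℝ) ^ 2 * (K * (n : ℝ) ^ (2 - p) * (harmonic n : ℝ) ^ 3) := by
            gcongr
            exact hW n hn
        _ = _ := by
            rw [show 1 - p - 1 = 2 - p - (2 : ℕ) by push_cast; ring,
              Real.rpow_sub_natCast hn0.ne']
            ring
    calc (∑ s ∈ Finset.Icc 2 n, ∫ ω, P.closing c s ω ∂P.μ) + ∫ ω, P.closing c (n + 1) ω ∂P.μ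
        ≤ K * (2 / (1 - p)) * (n : ℝ) ^ (1 - p) * (harmonic n : ℝ) ^ 3
          + K * (n : ℝ) ^ (1 - p - 1) * (harmonic n : ℝ) ^ 3 := add_le_add ih h1
      _ = K * (2 / (1 - p)) * ((n : ℝ) ^ (1 - p) + (1 - p) / 2 * (n : ℝ) ^ (1 - p - 1)) *
          (harmonic n : ℝ) ^ 3 := by field_simp
      _ ≤ K * (2 / (1 - p)) * ((n : ℝ) + 1) ^ (1 - p) * (harmonic (n + 1) : ℝ) ^ 3 := by
          gcongr
          exact rpow_add_rpow_sub_one_le hq (by linarith) hn1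
      _ = _ := by push_cast; rfl

lemma integral_sum_closing_le (t : ℕ) {f : P.Ω → ℝ} (hf0 : ∀ ω, 0 ≤ f ω)
    (hf : ∀ ω, f ω ≤ ∑ s ∈ Finset.Icc 2 t, (P.closing true s ω + P.closing false s ω)) :
    ∫ ω, f ω ∂P.μ ≤ (∑ s ∈ Finset.Icc 2 t, ∫ ω, P.closing true s ω ∂P.μ) +
      ∑ s ∈ Finset.Icc 2 t, ∫ ω, P.closing false s ω ∂P.μ := by
  have hi : ∀ c s, Integrable (P.closing c s) P.μ := fun c s =>
    (bddAdapted_closing c s).integrable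
  have hadd : ∀ s, Integrable (fun ω => P.closing true s ω + P.closing false s ω) P.μ :=
    fun s => (hi true s).add (hi false s)
  calc ∫ ω, f ω ∂P.μ
      ≤ ∫ ω, ∑ s ∈ Finset.Icc 2 t, (P.closing true s ω + P.closing false s ω) ∂P.μ :=
        integral_mono_of_nonneg (Eventually.of_forall hf0)
          (integrable_finsetSum _ fun s _ => hadd s)
          (Eventually.of_forall hf)
    _ = _ := by
        rw [integral_finsetSum _ fun s _ => hadd s,
          ← Finset.sum_add_distrib]
        exact Finset.sum_congr rfl fun s _ => integral_add (hi true s) (hi false s)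

end PAProcess

lemma harmonic_pow_three_le {t : ℕ} (ht : 2 ≤ t) :
    (harmonic t : ℝ) ^ 3 ≤ (1 + 1 / Real.log 2) ^ 6 * Real.log t ^ 6 := by
  have h2 : 0 < Real.log 2 := Real.log_pos (by norm_num)
  have hl : Real.log 2 ≤ Real.log t := Real.log_le_log (by norm_num) (by exact_mod_cast ht)
  have h1 : 1 ≤ 1 / Real.log 2 * Real.log t := by
    rw [one_div, ← div_eq_inv_mul, one_le_div h2]
    exact hl
  have hH : (harmonic t : ℝ) ≤ (1 + 1 / Real.log 2) * Real.log t := by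
    have := harmonic_le_one_add_log t
    linarith
  have hone := one_le_harmonic (t := t) (by omega)
  rw [← mul_pow]
  calc (harmonic t : ℝ) ^ 3 ≤ (harmonic t : ℝ) ^ 6 := pow_le_pow_right₀ hone (by norm_num)
    _ ≤ _ := by gcongr

/-- For `p ∈ (0,1)` and `α = (1-p)/(2-p)`, let `𝒯₂²(G_t)` be the number of triples
`i < j < k` with `i·j·k ≥ t^{3α}` forming a triangle in `G_t` in which one of the three
pairs is joined by an edge created at an edge-step and the remaining two pairs are joined by
edges created at vertex-steps.  Then there is `C > 0` (depending only on `p`) such that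
`E[𝒯₂²(G_t)] ≤ C t^{1-p} (log t)⁶` for all `t ≥ 2`. -/
theorem expected_T22_bound (p : ℝ) (hp0 : 0 < p) (hp1 : p < 1)
    (P : PAProcess p) :
    ∃ C : ℝ, 0 < C ∧
      ∀ t : ℕ, 2 ≤ t →
        ∫ ω, ((((Finset.Icc 1 t ×ˢ Finset.Icc 1 t ×ˢ Finset.Icc 1 t).filter
            (fun q => q.1 < q.2.1 ∧ q.2.1 < q.2.2 ∧
              (t : ℝ) ^ (3 * ((1 - p) / (2 - p))) ≤ ((q.1 * q.2.1 * q.2.2 : ℕ) : ℝ) ∧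
              ((P.EdgeJoined t q.1 q.2.1 ω ∧ P.VJoined t q.1 q.2.2 ω ∧
                  P.VJoined t q.2.1 q.2.2 ω) ∨
               (P.VJoined t q.1 q.2.1 ω ∧ P.EdgeJoined t q.1 q.2.2 ω ∧
                  P.VJoined t q.2.1 q.2.2 ω) ∨
               (P.VJoined t q.1 q.2.1 ω ∧ P.VJoined t q.1 q.2.2 ω ∧
                  P.EdgeJoined t q.2.1 q.2.2 ω)))).card : ℕ) : ℝ) ∂P.μ ≤
          C * (t : ℝ) ^ (1 - p) * Real.log t ^ 6 := by
  obtain ⟨K, hK, hKt⟩ := P.exists_sum_integral_closing_le true hp0.le hp1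
  obtain ⟨L, hL, hLt⟩ := P.exists_sum_integral_closing_le false hp0.le hp1
  have h2 : 0 < Real.log 2 := Real.log_pos (by norm_num)
  refine ⟨(K + L + 1) * (1 + 1 / Real.log 2) ^ 6, by positivity, fun t ht => ?_⟩
  refine (P.integral_sum_closing_le t (fun ω => Nat.cast_nonneg _) fun ω =>
    PAProcess.card_le_sum_closing fun q hq => ?_).trans ?_
  · obtain ⟨-, h1, h2, -, h3⟩ := Finset.mem_filter.1 hq
    exact ⟨h1, h2, h3⟩
  · have hH := harmonic_pow_three_le ht
    calc _ ≤ K * (t : ℝ) ^ (1 - p) * (harmonic t : ℝ) ^ 3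
          + L * (t : ℝ) ^ (1 - p) * (harmonic t : ℝ) ^ 3 :=
          add_le_add (hKt t (by omega)) (hLt t (by omega))
      _ = (K + L) * (t : ℝ) ^ (1 - p) * (harmonic t : ℝ) ^ 3 := by ring
      _ ≤ (K + L + 1) * (t : ℝ) ^ (1 - p) *
          ((1 + 1 / Real.log 2) ^ 6 * Real.log t ^ 6) := by
          have h0 : (0 : ℝ) ≤ (harmonic t : ℝ) ^ 3 :=
            pow_nonneg (zero_le_one.trans (one_le_harmonic (by omega))) 3
          refine mul_le_mul (mul_le_mul_of_nonneg_right (by linarith) (by positivity)) hH h0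
            (by positivity)
      _ = _ := by ring
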